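/- arXiv:1810.02185 — 2 statements merged into one kernel-verified Lean document; each statement's English description precedes it below -/
import Mathlib

section
/- Let K be an algebraically closed field, G an abelian group, and ε : G × G → K^× an alternating bicharacter. Let L and M be finite-dimensional colour Lie superalgebras over K with respect to (G, ε), each graded-simple as a G-graded algebra. If L and M satisfy the same G-graded polynomial identities, then L and M are isomorphic as G-graded algebras (hence as colour Lie superalgebras). -/
/-!
STATEMENT 10: Let K be an algebraically closed field, G an abelian group, and
ε : G × G → K^× an alternating bicharacter. Let L and M be finite-dimensional colour Lie
superalgebras over K with respect to (G, ε), each graded-simple as a G-graded algebra.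
If L and M satisfy the same G-graded polynomial identities, then L and M are isomorphic
as G-graded algebras (hence as colour Lie superalgebras).
-/

/-- `I` is a two-sided ideal of the (not necessarily associative or unital) `K`-algebra `A`. -/
def IsIdeal {K A : Type*} [Field K] [NonUnitalNonAssocRing A] [Module K A]
    (I : Submodule K A) : Prop :=
  ∀ a ∈ I, ∀ b : A, a * b ∈ I ∧ b * a ∈ I

/-- `I` is a graded ideal: a two-sided ideal with `I = ⊕_{g ∈ G} (I ∩ A_g)`. -/
def IsGradedIdeal {K G A : Type*} [Field K] [NonUnitalNonAssocRing A] [Module K A]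
    (𝒜 : G → Submodule K A) (I : Submodule K A) : Prop :=
  IsIdeal I ∧ I = ⨆ g, I ⊓ 𝒜 g

/-- `A` is graded-simple: `A·A ≠ 0` and the only graded ideals are `0` and `A`. -/
def IsGradedSimple {K G A : Type*} [Field K] [NonUnitalNonAssocRing A] [Module K A]
    (𝒜 : G → Submodule K A) : Prop :=
  (∃ a b : A, a * b ≠ 0) ∧
    ∀ I : Submodule K A, IsGradedIdeal 𝒜 I → I = ⊥ ∨ I = ⊤

/-- `f`, an element of the free nonassociative `G`-graded algebra `K⟨X^G⟩` (with `X = ℕ`,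
realized as the free non-unital non-associative algebra on `ℕ × G`, where `(x, g)` plays the
role of the generator `x^{(g)}`), is a `G`-graded polynomial identity of `A`. -/
def IsGradedPI {K G A : Type*} [Field K] [NonUnitalNonAssocRing A] [Module K A]
    [SMulCommClass K A A] [IsScalarTower K A A]
    (𝒜 : G → Submodule K A) (f : FreeNonUnitalNonAssocAlgebra K (ℕ × G)) : Prop :=
  ∀ e : ℕ × G → A, (∀ x g, e (x, g) ∈ 𝒜 g) →
    FreeNonUnitalNonAssocAlgebra.lift K e f = 0

/-- `A` and `B` are isomorphic as `G`-graded algebras. -/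
def IsGradedIso {K G A B : Type*} [Field K] [NonUnitalNonAssocRing A] [Module K A]
    [NonUnitalNonAssocRing B] [Module K B]
    (𝒜 : G → Submodule K A) (ℬ : G → Submodule K B) : Prop :=
  ∃ φ : A ≃ₗ[K] B, (∀ a b : A, φ (a * b) = φ a * φ b) ∧
    ∀ g, Submodule.map (φ : A →ₗ[K] B) (𝒜 g) = ℬ g

/-- `(A, 𝒜)` is a colour Lie superalgebra with respect to the abelian group `G` and the
alternating bicharacter `ε` (the product of the algebra `A` plays the role of the
bracket `[·,·]`): `[A_g, A_h] ⊆ A_{gh}`, ε-anticommutativity and the ε-Jacobi identity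
hold for homogeneous elements. -/
def IsColourLieSuperalgebra {K G A : Type*} [Field K] [CommGroup G]
    [NonUnitalNonAssocRing A] [Module K A] (ε : G → G → Kˣ)
    (𝒜 : G → Submodule K A) : Prop :=
  (∀ (g h : G), ∀ a ∈ 𝒜 g, ∀ b ∈ 𝒜 h, a * b ∈ 𝒜 (g * h)) ∧
  (∀ (g₁ g₂ : G) (x₁ x₂ : A), x₁ ∈ 𝒜 g₁ → x₂ ∈ 𝒜 g₂ →
      x₁ * x₂ = -((ε g₁ g₂ : K) • (x₂ * x₁))) ∧
  (∀ (g₁ g₂ g₃ : G) (x₁ x₂ x₃ : A), x₁ ∈ 𝒜 g₁ → x₂ ∈ 𝒜 g₂ → x₃ ∈ 𝒜 g₃ →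
      x₁ * (x₂ * x₃) = (x₁ * x₂) * x₃ + (ε g₁ g₂ : K) • (x₂ * (x₁ * x₃)))

theorem nonempty_algHom_of_isAlgClosed (K B : Type*) [Field K] [IsAlgClosed K] [CommRing B]
    [Algebra K B] [Nontrivial B] [Algebra.FiniteType K B] : Nonempty (B →ₐ[K] K) := by
  obtain ⟨m, hm⟩ := Ideal.exists_maximal B
  let := Ideal.Quotient.field m
  have := finite_of_finite_type_of_isJacobsonRing K (B ⧸ m)
  have hb : Function.Bijective (algebraMap K (B ⧸ m)) :=
    IsAlgClosed.algebraMap_bijective_of_isIntegral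
  exact ⟨((AlgEquiv.ofBijective (Algebra.ofId K (B ⧸ m)) hb).symm : (B ⧸ m) →ₐ[K] K).comp
    (Ideal.Quotient.mkₐ K m)⟩

universe u v in
/-- Ring homomorphisms with the same kernel can be completed to a commutative square with a
nontrivial corner. -/
theorem exists_nontrivial_amalgam {T : Type*} {A : Type u} {B : Type v} [CommRing T]
    [CommRing A] [CommRing B] [Nontrivial A] (f : T →+* A) (g : T →+* B)
    (h : RingHom.ker f = RingHom.ker g) :
    ∃ (F : Type (max u v)) (_ : CommRing F) (_ : Nontrivial F) (i : A →+* F) (j : B →+* F),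
      i.comp f = j.comp g := by
  obtain ⟨p, hp⟩ := (RingHom.ker f).nonempty_minimalPrimes (RingHom.ker_ne_top f)
  obtain ⟨q, hq, -, hqp⟩ := Ideal.exists_comap_eq_of_mem_minimalPrimes f (I := ⊥) p hp
  obtain ⟨r, hr, -, hrp⟩ := Ideal.exists_comap_eq_of_mem_minimalPrimes g (I := ⊥) p (by
    rw [h] at hp; exact hp)
  algebraize [Ideal.quotientMap q f hqp.ge, Ideal.quotientMap r g hrp.ge]
  have := Algebra.TensorProduct.nontrivial_of_algebraMap_injective_of_isDomain
    (T ⧸ p) (A ⧸ q) (B ⧸ r) (Ideal.quotientMap_injective' hqp.le)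
    (Ideal.quotientMap_injective' hrp.le)
  refine ⟨TensorProduct (T ⧸ p) (A ⧸ q) (B ⧸ r), inferInstance, this,
    Algebra.TensorProduct.includeLeftRingHom.comp (Ideal.Quotient.mk q),
    (Algebra.TensorProduct.includeRight (R := T ⧸ p) (A := A ⧸ q)
      (B := B ⧸ r)).toRingHom.comp (Ideal.Quotient.mk r), ?_⟩
  ext t
  have h1 : Ideal.Quotient.mk q (f t) = algebraMap (T ⧸ p) (A ⧸ q) (Ideal.Quotient.mk p t) := rfl
  have h2 : Ideal.Quotient.mk r (g t) = algebraMap (T ⧸ p) (B ⧸ r) (Ideal.Quotient.mk p t) := rfl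
  simp only [RingHom.comp_apply, h1, h2, AlgHom.toRingHom_eq_coe, AlgHom.coe_toRingHom,
    AlgHom.commutes]
  rfl

theorem exists_algHom_comp_eq_comp {K T A B : Type*} [Field K] [IsAlgClosed K] [CommRing T]
    [CommRing A] [CommRing B] [Algebra K T] [Algebra K A] [Algebra K B] [Nontrivial A]
    [Algebra.FiniteType K A] [Algebra.FiniteType K B] (f : T →ₐ[K] A) (g : T →ₐ[K] B)
    (h : RingHom.ker f.toRingHom = RingHom.ker g.toRingHom) :
    ∃ (χ : A →ₐ[K] K) (ψ : B →ₐ[K] K), χ.comp f = ψ.comp g := by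
  obtain ⟨F, _, _, i, j, hij⟩ := exists_nontrivial_amalgam f.toRingHom g.toRingHom h
  algebraize [i.comp (algebraMap K A)]
  let i' : A →ₐ[K] F := { i with commutes' := fun _ => rfl }
  let j' : B →ₐ[K] F :=
    { j with
      commutes' := fun c => by
        have := congr($hij (algebraMap K T c))
        simpa using! this.symm }
  let Φ := Algebra.TensorProduct.productMap i' j'
  have : Algebra.FiniteType K (TensorProduct K A B) :=
    .trans (S := A) inferInstance inferInstance
  have : Algebra.FiniteType K Φ.range :=
    .of_surjective Φ.rangeRestrict Φ.rangeRestrict_surjective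
  obtain ⟨θ⟩ := nonempty_algHom_of_isAlgClosed K Φ.range
  refine ⟨(θ.comp Φ.rangeRestrict).comp Algebra.TensorProduct.includeLeft,
    (θ.comp Φ.rangeRestrict).comp Algebra.TensorProduct.includeRight, ?_⟩
  ext t
  have : Φ (f t ⊗ₜ 1) = Φ (1 ⊗ₜ g t) := by
    simpa [Φ] using! congr($hij t)
  exact congrArg θ (Subtype.ext this)

theorem coe_aeval_adjoin_apply {K σ Z : Type*} [Field K] (r : σ → Z → K) (U : Set (Z → K))
    (hr : ∀ t, r t ∈ Algebra.adjoin K U) (P : MvPolynomial σ K) (z : Z) :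
    (MvPolynomial.aeval (fun t => (⟨r t, hr t⟩ : Algebra.adjoin K U)) P : Z → K) z =
      MvPolynomial.eval (fun t => r t z) P := by
  let ev : Algebra.adjoin K U →ₐ[K] K :=
    (Pi.evalAlgHom K (fun _ : Z => K) z).comp (Algebra.adjoin K U).val
  change ev (MvPolynomial.aeval _ P) = _
  rw [← AlgHom.comp_apply, MvPolynomial.comp_aeval]
  rfl

theorem exists_algHom_adjoin_eq {K σ X Y : Type*} [Field K] [IsAlgClosed K] [Nonempty X]
    (s : σ → X → K) (s' : σ → Y → K) (S : Set (X → K)) (S' : Set (Y → K))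
    (hS : S.Finite) (hS' : S'.Finite)
    (hs : ∀ t, s t ∈ Algebra.adjoin K S) (hs' : ∀ t, s' t ∈ Algebra.adjoin K S')
    (h : ∀ P : MvPolynomial σ K, (∀ x, MvPolynomial.eval (fun t => s t x) P = 0) ↔
      ∀ y, MvPolynomial.eval (fun t => s' t y) P = 0) :
    ∃ (χ : Algebra.adjoin K S →ₐ[K] K) (ψ : Algebra.adjoin K S' →ₐ[K] K),
      ∀ t, χ ⟨s t, hs t⟩ = ψ ⟨s' t, hs' t⟩ := by
  have : Algebra.FiniteType K (Algebra.adjoin K S) := .adjoin_of_finite hS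
  have : Algebra.FiniteType K (Algebra.adjoin K S') := .adjoin_of_finite hS'
  obtain ⟨χ, ψ, hχ⟩ := exists_algHom_comp_eq_comp
    (MvPolynomial.aeval (R := K) (fun t => (⟨s t, hs t⟩ : Algebra.adjoin K S)))
    (MvPolynomial.aeval (R := K) (fun t => (⟨s' t, hs' t⟩ : Algebra.adjoin K S'))) (by
      ext P
      simp only [RingHom.mem_ker, AlgHom.toRingHom_eq_coe, AlgHom.coe_toRingHom]
      rw [← Subtype.coe_inj, funext_iff, ← Subtype.coe_inj, funext_iff]
      simp only [coe_aeval_adjoin_apply]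
      exact h P)
  refine ⟨χ, ψ, fun t => ?_⟩
  simpa using congr($hχ (MvPolynomial.X t))

section HomogeneousPart

variable {K G A : Type*} [Field K] [DecidableEq G] [AddCommGroup A] [Module K A]

/-- The projection of a graded module onto its component of degree `g`. -/
noncomputable def homogeneousPart (𝒜 : G → Submodule K A) [DirectSum.Decomposition 𝒜] (g : G) :
    A →ₗ[K] A :=
  (𝒜 g).subtype ∘ₗ DirectSum.component K G (fun g => 𝒜 g) g ∘ₗ
    (DirectSum.decomposeLinearEquiv 𝒜).toLinearMap

variable {𝒜 : G → Submodule K A} [DirectSum.Decomposition 𝒜]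

theorem homogeneousPart_mem (g : G) (u : A) : homogeneousPart 𝒜 g u ∈ 𝒜 g :=
  (DirectSum.decompose 𝒜 u g).2

theorem homogeneousPart_of_mem {g : G} {u : A} (hu : u ∈ 𝒜 g) : homogeneousPart 𝒜 g u = u :=
  DirectSum.decompose_of_mem_same _ hu

theorem homogeneousPart_of_mem_ne {g h : G} {u : A} (hu : u ∈ 𝒜 g) (hgh : g ≠ h) :
    homogeneousPart 𝒜 h u = 0 :=
  DirectSum.decompose_of_mem_ne _ hu hgh

end HomogeneousPart

/-- The bases of `A` whose `i`-th member is homogeneous of degree `deg i`. -/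
abbrev HomogeneousBasis {K G A ι : Type*} [Field K] [NonUnitalNonAssocRing A] [Module K A]
    (𝒜 : G → Submodule K A) (deg : ι → G) :=
  {y : Module.Basis ι K A // ∀ i, y i ∈ 𝒜 (deg i)}

namespace HomogeneousBasis

section

variable {K G A ι : Type*} [Field K] [NonUnitalNonAssocRing A] [Module K A]
  {𝒜 : G → Submodule K A} {deg : ι → G}

/-- The structure constants of `A` in the basis `y`, as functions of `y`. -/
noncomputable def structConst (t : ι × ι × ι) (y : HomogeneousBasis 𝒜 deg) : K :=
  y.1.repr (y.1 t.1 * y.1 t.2.1) t.2.2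

variable (b : HomogeneousBasis 𝒜 deg)

/-- The coordinates of the members of `y` in the basis `b`, as functions of `y`. -/
noncomputable def coord (p : ι × ι) (y : HomogeneousBasis 𝒜 deg) : K := b.1.repr (y.1 p.1) p.2

/-- The coordinates of the members of `b` in the basis `y`, as functions of `y`. -/
noncomputable def invCoord (p : ι × ι) (y : HomogeneousBasis 𝒜 deg) : K := y.1.repr (b.1 p.1) p.2

/-- Generators of a coordinate ring of the variety of homogeneous bases. -/
def coordFunctions : Set (HomogeneousBasis 𝒜 deg → K) :=
  Set.range b.coord ∪ Set.range b.invCoord ∪ Set.range structConst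

theorem finite_coordFunctions [Finite ι] : b.coordFunctions.Finite :=
  ((Set.finite_range _).union (Set.finite_range _)).union (Set.finite_range _)

theorem structConst_mem (t : ι × ι × ι) :
    structConst t ∈ Algebra.adjoin K b.coordFunctions :=
  Algebra.subset_adjoin (Or.inr ⟨t, rfl⟩)

theorem coord_mem (p : ι × ι) : b.coord p ∈ Algebra.adjoin K b.coordFunctions :=
  Algebra.subset_adjoin (Or.inl (Or.inl ⟨p, rfl⟩))

theorem invCoord_mem (p : ι × ι) : b.invCoord p ∈ Algebra.adjoin K b.coordFunctions :=
  Algebra.subset_adjoin (Or.inl (Or.inr ⟨p, rfl⟩))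

theorem repr_eq_zero [DecidableEq G] [DirectSum.Decomposition 𝒜] {g : G} {u : A} (hu : u ∈ 𝒜 g)
    {i : ι} (hi : deg i ≠ g) : b.1.repr u i = 0 := by
  have h : b.1.coord i ∘ₗ homogeneousPart 𝒜 g = 0 := by
    refine b.1.ext fun j => ?_
    rw [LinearMap.comp_apply]
    by_cases hj : deg j = g
    · rw [homogeneousPart_of_mem (hj ▸ b.2 j)]
      have : j ≠ i := by rintro rfl; exact hi hj
      simp [this]
    · rw [homogeneousPart_of_mem_ne (b.2 j) hj]
      simp
  have := congr($h u)
  rwa [LinearMap.comp_apply, homogeneousPart_of_mem hu] at this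

theorem mem_iff [Fintype ι] [DecidableEq G] [DirectSum.Decomposition 𝒜] {g : G} {u : A} :
    u ∈ 𝒜 g ↔ ∀ i, deg i ≠ g → b.1.repr u i = 0 := by
  refine ⟨fun hu i hi => b.repr_eq_zero hu hi, fun h => ?_⟩
  rw [← b.1.sum_repr u]
  refine Submodule.sum_mem _ fun i _ => ?_
  by_cases hi : deg i = g
  · exact Submodule.smul_mem _ _ (hi ▸ b.2 i)
  · rw [h i hi, zero_smul]; exact zero_mem _

/-- A point of the variety of homogeneous bases is a homogeneous basis. -/
theorem exists_structConst_eq [Fintype ι] [DecidableEq G] [DirectSum.Decomposition 𝒜]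
    [SMulCommClass K A A] [IsScalarTower K A A]
    (χ : Algebra.adjoin K b.coordFunctions →ₐ[K] K) :
    ∃ y : HomogeneousBasis 𝒜 deg, ∀ t,
      structConst t y = χ ⟨structConst t, b.structConst_mem t⟩ := by
  classical
  set C : ι → ι → K := fun i j => χ ⟨b.coord (i, j), b.coord_mem _⟩ with hC
  set D : ι → ι → K := fun i j => χ ⟨b.invCoord (i, j), b.invCoord_mem _⟩ with hD
  set s : ι × ι × ι → K := fun t => χ ⟨structConst t, b.structConst_mem t⟩ with hs
  let y : ι → A := fun i => ∑ j, C i j • b.1 j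
  have hDC : ∀ i k, ∑ j, D i j * C j k = if i = k then 1 else 0 := by
    intro i k
    have h : ∑ j, (⟨b.invCoord (i, j), b.invCoord_mem _⟩ : Algebra.adjoin K b.coordFunctions) *
        ⟨b.coord (j, k), b.coord_mem _⟩ = if i = k then 1 else 0 := by
      apply Subtype.ext
      ext z
      have : ∑ j, z.1.repr (b.1 i) j * b.1.repr (z.1 j) k = if i = k then 1 else 0 := by
        have := congr(b.1.repr $(z.1.sum_repr (b.1 i)) k)
        rwa [map_sum, Finsupp.coe_finsetSum, Finset.sum_apply, b.1.repr_self_apply,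
          Finset.sum_congr rfl fun j _ => by rw [map_smul, Finsupp.smul_apply, smul_eq_mul]]
          at this
      split_ifs at this ⊢ <;> simpa [coord, invCoord] using! this
    have := congrArg χ h
    rw [map_sum] at this
    simpa only [map_mul, apply_ite χ, map_one, map_zero] using! this
  have hby : ∀ i, b.1 i = ∑ j, D i j • y j := by
    intro i
    simp only [y, Finset.smul_sum, smul_smul]
    rw [Finset.sum_comm]
    simp [← Finset.sum_smul, hDC]
  have hspan : ⊤ ≤ Submodule.span K (Set.range y) := by
    rw [← b.1.span_eq, Submodule.span_le]
    rintro _ ⟨i, rfl⟩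
    rw [hby]
    exact Submodule.sum_mem _ fun j _ =>
      Submodule.smul_mem _ _ (Submodule.subset_span ⟨j, rfl⟩)
  let Y := basisOfTopLeSpanOfCardEqFinrank y hspan (Module.finrank_eq_card_basis b.1).symm
  have hY : ∀ i, Y i = y i := fun i => by simp [Y]
  have hhom : ∀ i, Y i ∈ 𝒜 (deg i) := by
    intro i
    rw [hY, b.mem_iff]
    intro j hj
    have h : (⟨b.coord (i, j), b.coord_mem _⟩ : Algebra.adjoin K b.coordFunctions) = 0 := by
      apply Subtype.ext
      ext z
      exact b.repr_eq_zero (z.2 i) hj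
    have h' : C i j = 0 := by simp only [hC, h, map_zero]
    simp [y, Finsupp.single_apply, h']
  refine ⟨⟨Y, hhom⟩, ?_⟩
  have hmul : ∀ i j, Y i * Y j = ∑ k, s (i, j, k) • Y k := by
    intro i j
    refine b.1.ext_elem fun l => ?_
    have h : ∑ p, ∑ q, b.1.repr (b.1 p * b.1 q) l •
        ((⟨b.coord (i, p), b.coord_mem _⟩ : Algebra.adjoin K b.coordFunctions) *
          ⟨b.coord (j, q), b.coord_mem _⟩) =
        ∑ k, (⟨structConst (i, j, k), b.structConst_mem _⟩ :
          Algebra.adjoin K b.coordFunctions) * ⟨b.coord (k, l), b.coord_mem _⟩ := by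
      apply Subtype.ext
      ext z
      have h1 := congr(b.1.repr $(z.1.sum_repr (z.1 i * z.1 j)) l)
      conv_rhs at h1 => rw [← b.1.sum_repr (z.1 i), ← b.1.sum_repr (z.1 j)]
      simp only [Finset.sum_mul_sum, smul_mul_smul_comm, map_sum, map_smul, Finsupp.coe_finsetSum,
        Finset.sum_apply, Finsupp.smul_apply, smul_eq_mul] at h1
      simp only [AddSubmonoidClass.coe_finsetSum, Finset.sum_apply, Subalgebra.coe_smul,
        Subalgebra.coe_mul, Pi.smul_apply, Pi.mul_apply, smul_eq_mul]
      simp only [coord, structConst]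
      rw [h1]
      simp only [mul_comm]
    have h2 := congrArg χ h
    simp only [map_sum, map_smul, map_mul, smul_eq_mul] at h2
    simp only [hY, y, Finset.sum_mul_sum, smul_mul_smul_comm, map_sum, map_smul,
      Finsupp.coe_finsetSum, Finset.sum_apply, Finsupp.smul_apply, smul_eq_mul,
      Module.Basis.repr_self, Finsupp.single_apply]
    simp only [mul_ite, mul_one, mul_zero, Finset.sum_ite_eq', Finset.mem_univ, if_true]
    rw [← h2]
    exact Finset.sum_congr rfl fun p _ => Finset.sum_congr rfl fun q _ => mul_comm _ _
  rintro ⟨i, j, k⟩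
  simp [structConst, hmul, Finsupp.single_apply, s]

end

theorem isGradedIso_of_structConst_eq {K G A B ι : Type*} [Field K] [DecidableEq G] [Fintype ι]
    [NonUnitalNonAssocRing A] [Module K A] [SMulCommClass K A A] [IsScalarTower K A A]
    [NonUnitalNonAssocRing B] [Module K B] [SMulCommClass K B B] [IsScalarTower K B B]
    {𝒜 : G → Submodule K A} [DirectSum.Decomposition 𝒜]
    {ℬ : G → Submodule K B} [DirectSum.Decomposition ℬ] {deg : ι → G}
    (y : HomogeneousBasis 𝒜 deg) (y' : HomogeneousBasis ℬ deg)
    (h : ∀ t, structConst t y = structConst t y') : IsGradedIso 𝒜 ℬ := by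
  let φ : A ≃ₗ[K] B := y.1.equiv y'.1 (Equiv.refl ι)
  have hφ : ∀ i, φ (y.1 i) = y'.1 i := fun i => by simp [φ]
  have hrepr : ∀ u, y'.1.repr (φ u) = y.1.repr u := fun u => by simp [φ, Module.Basis.equiv]
  refine ⟨φ, fun a b => ?_, fun g => ?_⟩
  · have : (LinearMap.mul K A).compr₂ φ.toLinearMap =
        (LinearMap.mul K B).compl₁₂ φ.toLinearMap φ.toLinearMap := by
      refine y.1.ext fun i => y.1.ext fun j => y'.1.ext_elem fun k => ?_
      simpa [hφ, hrepr] using! h (i, j, k)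
    exact congr($this a b)
  · ext v
    rw [Submodule.mem_map]
    constructor
    · rintro ⟨u, hu, rfl⟩
      rw [y.mem_iff] at hu
      rw [y'.mem_iff]
      simpa only [LinearEquiv.coe_coe, hrepr] using! hu
    · intro hv
      refine ⟨φ.symm v, ?_, by simp⟩
      rw [y'.mem_iff] at hv
      rw [y.mem_iff]
      intro i hi
      rw [← hrepr, LinearEquiv.apply_symm_apply]
      exact hv i hi

end HomogeneousBasis

section Operators

variable {K A B ι : Type*} {n : ℕ} [Field K]
  [NonUnitalNonAssocRing A] [Module K A] [SMulCommClass K A A] [IsScalarTower K A A]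
  [NonUnitalNonAssocRing B] [Module K B] [SMulCommClass K B B] [IsScalarTower K B B]

/-- A noncommutative polynomial evaluated at the left multiplications by the `z i`. -/
noncomputable def opEval (z : ι → A) : FreeAlgebra K ι →ₐ[K] Module.End K A :=
  FreeAlgebra.lift K fun i => LinearMap.mulLeft K (z i)

omit [IsScalarTower K A A] in
theorem opEval_ι (z : ι → A) (i : ι) (a : A) :
    opEval (K := K) z (FreeAlgebra.ι K i) a = z i * a := by
  simp [opEval]

omit [IsScalarTower K A A] [IsScalarTower K B B] in
theorem map_opEval (φ : A →ₙₐ[K] B) (z : ι → A) (T : FreeAlgebra K ι) :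
    ∀ a, φ (opEval z T a) = opEval (φ ∘ z) T (φ a) := by
  induction T using FreeAlgebra.induction with
  | grade0 c => simp [map_smul]
  | grade1 i => simp [opEval_ι]
  | mul S T hS hT => simp [hS, hT]
  | add S T hS hT => simp [hS, hT]

/-- The operator `L_{T₀ y₀} ⋯ L_{Tₙ₋₁ yₙ₋₁} C` as a multilinear function of `y`, where `L` is left
multiplication and the `Tᵢ` and `C` are evaluated at the left multiplications by the `z i`. -/
noncomputable def wordOp (T : Fin n → FreeAlgebra K ι) (C : FreeAlgebra K ι) (z : ι → A) :
    MultilinearMap K (fun _ : Fin n => A) (Module.End K A) :=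
  (LinearMap.mulRight K (opEval z C)).compMultilinearMap
    ((MultilinearMap.mkPiAlgebraFin K n (Module.End K A)).compLinearMap
      fun i => LinearMap.mul K A ∘ₗ opEval z (T i))

theorem wordOp_apply (T : Fin n → FreeAlgebra K ι) (C : FreeAlgebra K ι) (z : ι → A)
    (y : Fin n → A) :
    wordOp T C z y =
      (List.ofFn fun i => (LinearMap.mul K A (opEval z (T i) (y i)) : Module.End K A)).prod *
        opEval z C :=
  rfl

theorem map_wordOp (φ : A →ₙₐ[K] B) (T : Fin n → FreeAlgebra K ι) (C : FreeAlgebra K ι)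
    (z : ι → A) (y : Fin n → A) (a : A) :
    φ (wordOp T C z y a) = wordOp T C (φ ∘ z) (φ ∘ y) (φ a) := by
  simp only [wordOp_apply, Module.End.mul_apply, ← map_opEval, List.ofFn_eq_map]
  generalize opEval z C a = c
  induction List.finRange n with
  | nil => simp
  | cons i l ih => simp [ih, map_opEval]

variable {G : Type*} [DecidableEq G]

/-- The alternating sum of `wordOp` over the degree-preserving permutations of its arguments. -/
noncomputable def altOp (deg : Fin n → G) (T : Fin n → FreeAlgebra K ι) (C : FreeAlgebra K ι)
    (z : ι → A) (y : Fin n → A) : Module.End K A :=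
  ∑ σ : Equiv.Perm (Fin n) with ∀ i, deg (σ i) = deg i,
    Equiv.Perm.sign σ • wordOp T C z (y ∘ σ)

theorem map_altOp (φ : A →ₙₐ[K] B) (deg : Fin n → G) (T : Fin n → FreeAlgebra K ι)
    (C : FreeAlgebra K ι) (z : ι → A) (y : Fin n → A) (a : A) :
    φ (altOp deg T C z y a) = altOp deg T C (φ ∘ z) (φ ∘ y) (φ a) := by
  simp only [altOp, LinearMap.sum_apply, map_sum, Units.smul_def, LinearMap.smul_apply, map_zsmul,
    map_wordOp]
  rfl

theorem map_altOp_pow (φ : A →ₙₐ[K] B) (deg : Fin n → G) (T : Fin n → FreeAlgebra K ι)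
    (C : FreeAlgebra K ι) (z : ι → A) (y : Fin n → A) (N : ℕ) (a : A) :
    φ ((altOp deg T C z y ^ N) a) = (altOp deg T C (φ ∘ z) (φ ∘ y) ^ N) (φ a) := by
  induction N generalizing a with
  | zero => simp
  | succ N ih => rw [pow_succ, pow_succ, Module.End.mul_apply, Module.End.mul_apply, ih, map_altOp]

/-- The alternating map on all of `A` that agrees with `altOp` on homogeneous arguments. -/
noncomputable def altOpMap (𝒜 : G → Submodule K A) [DirectSum.Decomposition 𝒜] (deg : Fin n → G)
    (T : Fin n → FreeAlgebra K ι) (C : FreeAlgebra K ι) (z : ι → A) :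
    A [⋀^Fin n]→ₗ[K] Module.End K A :=
  MultilinearMap.alternatization
    ((wordOp T C z).compLinearMap fun i => homogeneousPart 𝒜 (deg i))

variable {𝒜 : G → Submodule K A} [DirectSum.Decomposition 𝒜] {deg : Fin n → G}

theorem altOp_eq_altOpMap (T : Fin n → FreeAlgebra K ι) (C : FreeAlgebra K ι) (z : ι → A)
    {y : Fin n → A} (hy : ∀ i, y i ∈ 𝒜 (deg i)) :
    altOp deg T C z y = altOpMap 𝒜 deg T C z y := by
  rw [altOpMap, MultilinearMap.alternatization_apply, altOp, Finset.sum_filter]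
  refine Finset.sum_congr rfl fun σ _ => ?_
  rw [MultilinearMap.domDomCongr_apply, MultilinearMap.compLinearMap_apply]
  split_ifs with hσ
  · congr 2
    ext i
    exact (homogeneousPart_of_mem (hσ i ▸ hy (σ i))).symm
  · obtain ⟨i, hi⟩ := not_forall.mp hσ
    rw [MultilinearMap.map_coord_zero _ i, smul_zero]
    exact homogeneousPart_of_mem_ne (hy (σ i)) hi

theorem altOp_eq_zero (T : Fin n → FreeAlgebra K ι) (C : FreeAlgebra K ι) (z : ι → A)
    {y : Fin n → A} (hy : ∀ i, y i ∈ 𝒜 (deg i)) (h : ¬LinearIndependent K y) :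
    altOp deg T C z y = 0 := by
  rw [altOp_eq_altOpMap T C z hy]
  exact AlternatingMap.map_linearDependent _ _ h

theorem altOp_update (T : Fin n → FreeAlgebra K ι) (C : FreeAlgebra K ι) (z : ι → A)
    (y : HomogeneousBasis 𝒜 deg) (k : Fin n) {u : A} (hu : u ∈ 𝒜 (deg k)) :
    altOp deg T C z (Function.update y.1 k u) = y.1.repr u k • altOp deg T C z y.1 := by
  have hmem : ∀ i, Function.update y.1 k u i ∈ 𝒜 (deg i) := by
    intro i
    rcases eq_or_ne i k with rfl | h
    · simpa using hu
    · simpa [h] using y.2 i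
  rw [altOp_eq_altOpMap T C z hmem, altOp_eq_altOpMap T C z y.2]
  conv_lhs => rw [← y.1.sum_repr u]
  rw [AlternatingMap.map_update_sum, Finset.sum_eq_single k]
  · rw [AlternatingMap.map_update_smul, Function.update_eq_self]
  · intro j _ hj
    rw [AlternatingMap.map_update_smul, AlternatingMap.map_update_self _ _ hj.symm, smul_zero]
  · simp

theorem exists_altOp_eq_smul (T : Fin n → FreeAlgebra K ι) (C : FreeAlgebra K ι) (z : ι → A)
    (y : HomogeneousBasis 𝒜 deg) {u : Fin n → A} (hu : ∀ i, u i ∈ 𝒜 (deg i)) :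
    ∃ c : K, altOp deg T C z u = c • altOp deg T C z y.1 := by
  refine ⟨y.1.det u, ?_⟩
  rw [altOp_eq_altOpMap T C z hu, altOp_eq_altOpMap T C z y.2]
  generalize altOpMap 𝒜 deg T C z = f
  have : f = (LinearMap.toSpanSingleton K _ (f y.1)).compAlternatingMap y.1.det := by
    refine Module.Basis.ext_alternating y.1 fun v hv => ?_
    let σ : Equiv.Perm (Fin n) := Equiv.ofBijective v (Finite.injective_iff_bijective.1 hv)
    change f (y.1 ∘ σ) = y.1.det (y.1 ∘ σ) • f y.1
    rw [AlternatingMap.map_perm, AlternatingMap.map_perm, Module.Basis.det_self]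
    rcases Int.units_eq_one_or (Equiv.Perm.sign σ) with h | h <;> simp [h]
  exact congr($this u)

end Operators

section Density

variable {K G A : Type*} [Field K] [CommGroup G] [DecidableEq G]
  [NonUnitalNonAssocRing A] [Module K A] [SMulCommClass K A A] [IsScalarTower K A A]
  {ε : G → G → Kˣ} {𝒜 : G → Submodule K A} [DirectSum.Decomposition 𝒜]

omit [CommGroup G] [SMulCommClass K A A] [IsScalarTower K A A] in
theorem mem_of_homogeneousPart_mem {I : Submodule K A} {u : A}
    (h : ∀ g, homogeneousPart 𝒜 g u ∈ I) : u ∈ I := by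
  classical
  rw [← DirectSum.sum_support_decompose 𝒜 u]
  exact Submodule.sum_mem _ fun g _ => h g

omit [SMulCommClass K A A] [IsScalarTower K A A] in
theorem IsColourLieSuperalgebra.isGradedIdeal (hA : IsColourLieSuperalgebra ε 𝒜)
    {I : Submodule K A} (hpart : ∀ u ∈ I, ∀ g, homogeneousPart 𝒜 g u ∈ I)
    (hmul : ∀ g, ∀ a ∈ 𝒜 g, ∀ u ∈ I, a * u ∈ I) : IsGradedIdeal 𝒜 I := by
  classical
  refine ⟨fun u hu a => ?_, le_antisymm (fun u hu => ?_) (iSup_le fun g => inf_le_left)⟩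
  · rw [← DirectSum.sum_support_decompose 𝒜 a]
    constructor
    · rw [Finset.mul_sum]
      refine Submodule.sum_mem _ fun g _ => ?_
      rw [← DirectSum.sum_support_decompose 𝒜 u, Finset.sum_mul]
      refine Submodule.sum_mem _ fun h _ => ?_
      rw [hA.2.1 h g _ _ (SetLike.coe_mem _) (SetLike.coe_mem _)]
      exact neg_mem (Submodule.smul_mem _ _
        (hmul g _ (SetLike.coe_mem _) _ (hpart u hu h)))
    · rw [Finset.sum_mul]
      exact Submodule.sum_mem _ fun g _ => hmul g _ (SetLike.coe_mem _) u hu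
  · exact mem_of_homogeneousPart_mem fun g =>
      Submodule.mem_iSup_of_mem g ⟨hpart u hu g, homogeneousPart_mem g u⟩

omit [IsScalarTower K A A] in
theorem exists_homogeneous_mul_ne_zero (hA : IsColourLieSuperalgebra ε 𝒜)
    (hs : IsGradedSimple 𝒜) {g : G} {u : A} (hu : u ∈ 𝒜 g) (hu0 : u ≠ 0) :
    ∃ (h : G) (a : A), a ∈ 𝒜 h ∧ a * u ∈ 𝒜 (h * g) ∧ a * u ≠ 0 := by
  classical
  by_contra! hcon
  let Z : Submodule K A :=
    ⨅ (a : A) (h : G), LinearMap.ker (LinearMap.mulLeft K a ∘ₗ homogeneousPart 𝒜 h)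
  have hZ : ∀ v, v ∈ Z ↔ ∀ a h, a * homogeneousPart 𝒜 h v = 0 := fun v => by
    simp [Z, Submodule.mem_iInf]
  have hZ' : ∀ v ∈ Z, ∀ a, a * v = 0 := by
    intro v hv a
    rw [hZ] at hv
    rw [← DirectSum.sum_support_decompose 𝒜 v, Finset.mul_sum]
    exact Finset.sum_eq_zero fun h _ => hv a h
  have huZ : u ∈ Z := by
    rw [hZ]
    intro a h
    rcases eq_or_ne g h with rfl | hgh
    · rw [homogeneousPart_of_mem hu, ← DirectSum.sum_support_decompose 𝒜 a, Finset.sum_mul]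
      refine Finset.sum_eq_zero fun k _ => hcon k _ (SetLike.coe_mem _) ?_
      exact hA.1 _ _ _ (SetLike.coe_mem _) _ hu
    · rw [homogeneousPart_of_mem_ne hu hgh, mul_zero]
  have hgr : IsGradedIdeal 𝒜 Z := by
    refine hA.isGradedIdeal (fun v hv g => ?_) fun g a _ v hv => ?_
    · rw [hZ]
      intro a h
      rcases eq_or_ne g h with rfl | hgh
      · rw [homogeneousPart_of_mem (homogeneousPart_mem g v)]
        exact (hZ v).1 hv a g
      · rw [homogeneousPart_of_mem_ne (homogeneousPart_mem g v) hgh, mul_zero]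
    · rw [hZ' v hv a]
      exact zero_mem _
  rcases hs.2 Z hgr with h | h
  · rw [h, Submodule.mem_bot] at huZ
    exact hu0 huZ
  · obtain ⟨a, b, hab⟩ := hs.1
    exact hab (hZ' b (h ▸ Submodule.mem_top) a)

variable {ι : Type*} {deg : ι → G}

/-- **Burnside's theorem** for graded-simple algebras: left multiplications and projections onto
homogeneous components generate all linear operators. -/
theorem adjoin_mulLeft_homogeneousPart_eq_top [IsAlgClosed K] [FiniteDimensional K A] [Finite ι]
    (hA : IsColourLieSuperalgebra ε 𝒜) (hs : IsGradedSimple 𝒜)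
    (b : HomogeneousBasis 𝒜 deg) :
    Algebra.adjoin K (Set.range (fun i => LinearMap.mulLeft K (b.1 i)) ∪
      Set.range (homogeneousPart 𝒜)) = (⊤ : Subalgebra K (Module.End K A)) := by
  classical
  cases nonempty_fintype ι
  set S := Algebra.adjoin K (Set.range (fun i => LinearMap.mulLeft K (b.1 i)) ∪
      Set.range (homogeneousPart 𝒜)) with hS
  have hmulS : ∀ i, LinearMap.mulLeft K (b.1 i) ∈ S := fun i =>
    Algebra.subset_adjoin (Or.inl ⟨i, rfl⟩)
  have hpartS : ∀ g, homogeneousPart 𝒜 g ∈ S := fun g => Algebra.subset_adjoin (Or.inr ⟨g, rfl⟩)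
  have : Nontrivial A := by
    obtain ⟨a, c, h⟩ := hs.1
    exact ⟨_, _, h⟩
  have : IsSimpleModule S A := by
    refine (isSimpleModule_iff ..).2 { eq_bot_or_eq_top := fun N => ?_ }
    have hgr : IsGradedIdeal 𝒜 (N.restrictScalars K) := by
      refine hA.isGradedIdeal (fun u hu g => N.smul_mem ⟨_, hpartS g⟩ hu) fun g a _ u hu => ?_
      rw [← b.1.sum_repr a, Finset.sum_mul]
      refine Submodule.sum_mem _ fun i _ => ?_
      rw [smul_mul_assoc]
      exact Submodule.smul_mem _ _ (N.smul_mem ⟨_, hmulS i⟩ hu)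
    simpa using hs.2 _ hgr
  rw [eq_top_iff]
  rintro f -
  let f' : Module.End (Module.End S A) A :=
    { f with
      map_smul' := fun c u => by
        obtain ⟨k, rfl⟩ :=
          (IsSimpleModule.algebraMap_end_bijective_of_isAlgClosed (A := S) (V := A) K).2 c
        exact f.map_smul k u }
  obtain ⟨r, hr⟩ := jacobson_density f' (Finset.univ.image b.1)
  have : f = r := b.1.ext fun i => hr _ (by simp)
  rw [this]
  exact r.2

/-- On a homogeneous component, each homogeneous part of a linear operator is a polynomial in the
left multiplications by the members of a homogeneous basis. -/
theorem exists_opEval_eq [IsAlgClosed K] [FiniteDimensional K A] [Finite ι]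
    (hA : IsColourLieSuperalgebra ε 𝒜) (hs : IsGradedSimple 𝒜) (b : HomogeneousBasis 𝒜 deg)
    (f : Module.End K A) : ∀ g h : G, ∃ W : FreeAlgebra K ι, ∀ u ∈ 𝒜 g,
      opEval b.1 W u = homogeneousPart 𝒜 h (f u) := by
  classical
  cases nonempty_fintype ι
  have hf : f ∈ (⊤ : Subalgebra K (Module.End K A)) := trivial
  rw [← adjoin_mulLeft_homogeneousPart_eq_top hA hs b] at hf
  induction hf using Algebra.adjoin_induction with
  | mem f hf =>
    rcases hf with ⟨i, rfl⟩ | ⟨k, rfl⟩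
    · intro g h
      by_cases hd : deg i * g = h
      · refine ⟨FreeAlgebra.ι K i, fun u hu => ?_⟩
        rw [opEval_ι, LinearMap.mulLeft_apply,
          homogeneousPart_of_mem (hd ▸ hA.1 _ _ _ (b.2 i) _ hu)]
      · refine ⟨0, fun u hu => ?_⟩
        rw [LinearMap.mulLeft_apply,
          homogeneousPart_of_mem_ne (hA.1 _ _ _ (b.2 i) _ hu) hd, map_zero, LinearMap.zero_apply]
    · intro g h
      by_cases hd : g = k ∧ g = h
      · obtain ⟨rfl, rfl⟩ := hd
        refine ⟨1, fun u hu => ?_⟩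
        simp [homogeneousPart_of_mem hu]
      · refine ⟨0, fun u hu => ?_⟩
        rcases eq_or_ne g k with rfl | hk
        · rw [homogeneousPart_of_mem hu, homogeneousPart_of_mem_ne hu fun h => hd ⟨rfl, h⟩]
          simp
        · simp [homogeneousPart_of_mem_ne hu hk]
  | algebraMap c =>
    intro g h
    by_cases hd : g = h
    · refine ⟨algebraMap K _ c, fun u hu => ?_⟩
      subst hd
      simp [homogeneousPart_of_mem hu]
    · refine ⟨0, fun u hu => ?_⟩
      simp [homogeneousPart_of_mem_ne hu hd]
  | add f₁ f₂ _ _ h₁ h₂ =>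
    intro g h
    obtain ⟨W₁, hW₁⟩ := h₁ g h
    obtain ⟨W₂, hW₂⟩ := h₂ g h
    exact ⟨W₁ + W₂, fun u hu => by simp [hW₁ u hu, hW₂ u hu]⟩
  | mul f₁ f₂ _ _ h₁ h₂ =>
    intro g h
    choose W₁ hW₁ using fun k => h₁ k h
    choose W₂ hW₂ using fun k => h₂ g k
    refine ⟨∑ k ∈ Finset.univ.image deg, W₁ k * W₂ k, fun u hu => ?_⟩
    have hsum : ∀ v : A, v = ∑ k ∈ Finset.univ.image deg, homogeneousPart 𝒜 k v := by
      intro v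
      have : LinearMap.id = ∑ k ∈ Finset.univ.image deg, homogeneousPart 𝒜 k := by
        refine b.1.ext fun i => ?_
        rw [LinearMap.sum_apply, Finset.sum_eq_single (deg i), homogeneousPart_of_mem (b.2 i)]
        · rfl
        · exact fun k _ hk => homogeneousPart_of_mem_ne (b.2 i) hk.symm
        · simp
      simpa using congr($this v)
    rw [Module.End.mul_apply, hsum (f₂ u)]
    simp only [map_sum, map_mul, LinearMap.sum_apply, Module.End.mul_apply]
    refine Finset.sum_congr rfl fun k _ => ?_
    rw [hW₂ k u hu, hW₁ k _ (homogeneousPart_mem k _)]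

theorem exists_prod_mul_ne_zero (hA : IsColourLieSuperalgebra ε 𝒜) (hs : IsGradedSimple 𝒜)
    {g : G} {u : A} (hu : u ∈ 𝒜 g) (hu0 : u ≠ 0) (n : ℕ) :
    ∃ (w : Fin n → A) (e : Fin n → G) (h : G), (∀ i, w i ∈ 𝒜 (e i)) ∧
      (List.ofFn fun i => (LinearMap.mul K A (w i) : Module.End K A)).prod u ∈ 𝒜 h ∧
      (List.ofFn fun i => (LinearMap.mul K A (w i) : Module.End K A)).prod u ≠ 0 := by
  induction n with
  | zero => exact ⟨Fin.elim0, Fin.elim0, g, fun i => i.elim0, by simpa using hu, by simpa using hu0⟩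
  | succ n ih =>
    obtain ⟨w, e, h, hw, hmem, hne⟩ := ih
    obtain ⟨k, a, ha, hak, hane⟩ := exists_homogeneous_mul_ne_zero hA hs hmem hne
    refine ⟨Fin.cons a w, Fin.cons k e, k * h, Fin.cases ha hw, ?_, ?_⟩ <;>
    simpa [List.ofFn_succ]

/-- An alternating operator with eigenvalue `1` at a homogeneous basis. -/
theorem exists_altOp_eigenvector [IsAlgClosed K] [FiniteDimensional K A] {n : ℕ}
    {deg : Fin n → G} (hA : IsColourLieSuperalgebra ε 𝒜) (hs : IsGradedSimple 𝒜)
    (b : HomogeneousBasis 𝒜 deg) :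
    ∃ (T : Fin n → FreeAlgebra K (Fin n)) (C : FreeAlgebra K (Fin n)) (h : G) (v : A),
      v ∈ 𝒜 h ∧ v ≠ 0 ∧ altOp deg T C b.1 b.1 v = v := by
  classical
  obtain ⟨i₀⟩ : Nonempty (Fin n) := by
    obtain ⟨a, c, h⟩ := hs.1
    have : Nontrivial A := ⟨_, _, h⟩
    exact b.1.index_nonempty
  obtain ⟨w, e, h, hw, hmem, hne⟩ :=
    exists_prod_mul_ne_zero hA hs (b.2 i₀) (b.1.ne_zero i₀) n
  choose T hT using fun i => exists_opEval_eq hA hs b ((b.1.coord i).smulRight (w i)) (deg i) (e i)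
  obtain ⟨f, hf⟩ := Module.Projective.exists_dual_ne_zero K hne
  set v := (List.ofFn fun i => (LinearMap.mul K A (w i) : Module.End K A)).prod (b.1 i₀) with hv
  obtain ⟨C, hC⟩ := exists_opEval_eq hA hs b (((f v)⁻¹ • f).smulRight (b.1 i₀)) h (deg i₀)
  have hCv : opEval b.1 C v = b.1 i₀ := by
    rw [hC v hmem]
    simp [hf, homogeneousPart_of_mem (b.2 i₀)]
  have hTb : ∀ i j, deg j = deg i → opEval b.1 (T i) (b.1 j) = if j = i then w i else 0 := by
    intro i j hij
    rw [hT i _ (hij ▸ b.2 j)]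
    by_cases h : j = i
    · simp [h, homogeneousPart_of_mem (hw i)]
    · simp [h]
  refine ⟨T, C, h, v, hmem, hne, ?_⟩
  rw [altOp, Finset.sum_eq_single 1]
  · simp only [wordOp_apply, Equiv.Perm.sign_one, one_smul, Equiv.Perm.coe_one, Function.comp_id,
      hTb _ _ rfl, if_true, Module.End.mul_apply, hCv]
    exact hv.symm
  · intro σ hσ hσ1
    obtain ⟨i, hi⟩ : ∃ i, σ i ≠ i := by
      by_contra! hcon
      exact hσ1 (Equiv.ext hcon)
    rw [wordOp_apply, List.prod_eq_zero, zero_mul, smul_zero]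
    rw [List.mem_ofFn]
    refine ⟨i, ?_⟩
    rw [Function.comp_apply, hTb i _ ((Finset.mem_filter.mp hσ).2 i), if_neg hi, map_zero]
  · simp

end Density

section Transfer

variable {K G A B : Type*} [Field K]
  [NonUnitalNonAssocRing A] [Module K A] [SMulCommClass K A A] [IsScalarTower K A A]
  [NonUnitalNonAssocRing B] [Module K B] [SMulCommClass K B B] [IsScalarTower K B B]
  {𝒜 : G → Submodule K A} {ℬ : G → Submodule K B}

/-- An inclusion of graded identities holds for polynomials in any countable set of homogeneous
variables. -/
theorem lift_eq_zero_of_isGradedPI_imp {κ : Type*} [Encodable κ]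
    (hPI : ∀ f : FreeNonUnitalNonAssocAlgebra K (ℕ × G), IsGradedPI 𝒜 f → IsGradedPI ℬ f)
    (d : κ → G) (f : FreeNonUnitalNonAssocAlgebra K κ)
    (hf : ∀ e : κ → A, (∀ k, e k ∈ 𝒜 (d k)) → FreeNonUnitalNonAssocAlgebra.lift K e f = 0)
    (e : κ → B) (he : ∀ k, e k ∈ ℬ (d k)) : FreeNonUnitalNonAssocAlgebra.lift K e f = 0 := by
  classical
  let r : κ → ℕ × G := fun k => (Encodable.encode k, d k)
  have hr : Function.Injective r := fun k l h => Encodable.encode_injective (congrArg Prod.fst h)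
  let φ := FreeNonUnitalNonAssocAlgebra.lift K fun k => FreeNonUnitalNonAssocAlgebra.of K (r k)
  have h₁ : ∀ e' : ℕ × G → A, (FreeNonUnitalNonAssocAlgebra.lift K e').comp φ =
      FreeNonUnitalNonAssocAlgebra.lift K (e' ∘ r) := fun e' =>
    FreeNonUnitalNonAssocAlgebra.hom_ext _ fun k => by simp [φ]
  have h₂ : ∀ e' : ℕ × G → B, (FreeNonUnitalNonAssocAlgebra.lift K e').comp φ =
      FreeNonUnitalNonAssocAlgebra.lift K (e' ∘ r) := fun e' =>
    FreeNonUnitalNonAssocAlgebra.hom_ext _ fun k => by simp [φ]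
  have hφ : IsGradedPI 𝒜 (φ f) := fun e' he' => by
    rw [← NonUnitalAlgHom.comp_apply, h₁]
    exact hf _ fun k => he' _ _
  have := hPI _ hφ (Function.extend r e 0) fun m g => by
    by_cases h : ∃ k, r k = (m, g)
    · obtain ⟨k, hk⟩ := h
      have hg : d k = g := congrArg Prod.snd hk
      rw [← hk, hr.extend_apply, ← hg]
      exact he k
    · rw [Function.extend_apply' _ _ _ h]
      exact zero_mem _
  have hext : Function.extend r e 0 ∘ r = e := funext fun k => hr.extend_apply ..
  rwa [← NonUnitalAlgHom.comp_apply, h₂, hext] at this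

variable [DecidableEq G] {n : ℕ}

/-- Variables for the arguments `z` and `y` of `altOp` and for a vector. -/
abbrev OpVar (n : ℕ) : Type := Fin n ⊕ Fin n ⊕ Unit

/-- The assignment of `z`, `y` and `x` to the variables `OpVar n`. -/
def OpVar.assign {X : Type*} (z y : Fin n → X) (x : X) : OpVar n → X :=
  Sum.elim z (Sum.elim y fun _ => x)

theorem OpVar.assign_eq {X : Type*} (e : OpVar n → X) :
    e = assign (e ∘ Sum.inl) (e ∘ Sum.inr ∘ Sum.inl) (e (Sum.inr (Sum.inr ()))) := by
  ext (_ | _ | _) <;> rfl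

omit [SMulCommClass K A A] [IsScalarTower K A A] [DecidableEq G] in
theorem OpVar.assign_mem {deg : Fin n → G} {h : G} {z y : Fin n → A} {x : A}
    (hz : ∀ i, z i ∈ 𝒜 (deg i)) (hy : ∀ i, y i ∈ 𝒜 (deg i)) (hx : x ∈ 𝒜 h) :
    ∀ k, assign z y x k ∈ 𝒜 (assign deg deg h k)
  | .inl i => hz i
  | .inr (.inl i) => hy i
  | .inr (.inr _) => hx

variable (K) in
/-- The free variable attached to an element of `OpVar n`. -/
noncomputable abbrev OpVar.X (k : OpVar n) : FreeNonUnitalNonAssocAlgebra K (OpVar n) :=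
  FreeNonUnitalNonAssocAlgebra.of K k

theorem lift_altOp_pow (deg : Fin n → G) (T : Fin n → FreeAlgebra K (Fin n))
    (C : FreeAlgebra K (Fin n)) (z y : Fin n → A) (x : A) (N : ℕ)
    (W : FreeNonUnitalNonAssocAlgebra K (OpVar n)) :
    FreeNonUnitalNonAssocAlgebra.lift K (OpVar.assign z y x)
      ((altOp deg T C (fun i => OpVar.X K (.inl i)) (fun i => OpVar.X K (.inr (.inl i))) ^ N) W) =
    (altOp deg T C z y ^ N) (FreeNonUnitalNonAssocAlgebra.lift K (OpVar.assign z y x) W) := by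
  rw [map_altOp_pow]
  congr <;>
  · ext i
    simp [OpVar.assign]

/-- `W` evaluates to the value at the structure constants of `y` of the polynomial `P`, times the
`N`-th power of the alternating operator. -/
def Represents (𝒜 : G → Submodule K A) (deg : Fin n → G) (T : Fin n → FreeAlgebra K (Fin n))
    (C : FreeAlgebra K (Fin n)) (N : ℕ) (P : MvPolynomial (Fin n × Fin n × Fin n) K)
    (W : FreeNonUnitalNonAssocAlgebra K (OpVar n)) : Prop :=
  ∀ (z : Fin n → A) (y : HomogeneousBasis 𝒜 deg) (x : A),
    FreeNonUnitalNonAssocAlgebra.lift K (OpVar.assign z y.1 x) W =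
      MvPolynomial.eval (fun t => HomogeneousBasis.structConst t y) P •
        (altOp deg T C z y.1 ^ N) x

namespace Represents

variable {deg : Fin n → G} {T : Fin n → FreeAlgebra K (Fin n)} {C : FreeAlgebra K (Fin n)}
  {N : ℕ} {P Q : MvPolynomial (Fin n × Fin n × Fin n) K}
  {W V : FreeNonUnitalNonAssocAlgebra K (OpVar n)}

theorem const (c : K) :
    Represents 𝒜 deg T C 0 (MvPolynomial.C c) (c • OpVar.X K (.inr (.inr ()))) := by
  intro z y x
  rw [map_smul, FreeNonUnitalNonAssocAlgebra.lift_of_apply]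
  simp [OpVar.assign]

theorem add (hW : Represents 𝒜 deg T C N P W) (hV : Represents 𝒜 deg T C N Q V) :
    Represents 𝒜 deg T C N (P + Q) (W + V) := by
  intro z y x
  rw [map_add, hW, hV, map_add, add_smul]

theorem pow_altOp (hW : Represents 𝒜 deg T C N P W) (m : ℕ) :
    Represents 𝒜 deg T C (m + N) P
      ((altOp deg T C (fun i => OpVar.X K (.inl i)) (fun i => OpVar.X K (.inr (.inl i))) ^ m) W) := by
  intro z y x
  rw [lift_altOp_pow, hW, map_smul, pow_add, Module.End.mul_apply]

theorem mul_X [Mul G] [DirectSum.Decomposition 𝒜]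
    (hmul : ∀ g h : G, ∀ a ∈ 𝒜 g, ∀ b ∈ 𝒜 h, a * b ∈ 𝒜 (g * h))
    (hW : Represents 𝒜 deg T C N P W) (i j k : Fin n) :
    Represents 𝒜 deg T C (N + 1) (P * MvPolynomial.X (i, j, k))
      (if deg i * deg j = deg k then
        altOp deg T C (fun i => OpVar.X K (.inl i))
          (Function.update (fun i => OpVar.X K (.inr (.inl i))) k
            (OpVar.X K (.inr (.inl i)) * OpVar.X K (.inr (.inl j)))) W
      else 0) := by
  intro z y x
  have hij := hmul _ _ _ (y.2 i) _ (y.2 j)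
  rw [map_mul, MvPolynomial.eval_X]
  split_ifs with hk
  · rw [map_altOp, hW, Function.comp_update, map_mul, map_smul]
    have hz : FreeNonUnitalNonAssocAlgebra.lift K (OpVar.assign z y.1 x) ∘
        (fun i => OpVar.X K (.inl i)) = z := by ext i; simp [OpVar.assign]
    have hy : FreeNonUnitalNonAssocAlgebra.lift K (OpVar.assign z y.1 x) ∘
        (fun i => OpVar.X K (.inr (.inl i))) = y.1 := by ext i; simp [OpVar.assign]
    rw [hz, hy, FreeNonUnitalNonAssocAlgebra.lift_of_apply,
      FreeNonUnitalNonAssocAlgebra.lift_of_apply]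
    change _ • altOp deg T C z (Function.update y.1 k (y.1 i * y.1 j)) _ = _
    rw [altOp_update T C z y k (hk ▸ hij), pow_succ', Module.End.mul_apply, LinearMap.smul_apply,
      smul_smul]
    rfl
  · have : HomogeneousBasis.structConst (i, j, k) y = 0 :=
      y.repr_eq_zero hij (Ne.symm hk)
    rw [this, mul_zero, zero_smul, map_zero]

end Represents

theorem exists_represents [Mul G] [DirectSum.Decomposition 𝒜] [DirectSum.Decomposition ℬ]
    (h𝒜 : ∀ g h : G, ∀ a ∈ 𝒜 g, ∀ b ∈ 𝒜 h, a * b ∈ 𝒜 (g * h))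
    (hℬ : ∀ g h : G, ∀ a ∈ ℬ g, ∀ b ∈ ℬ h, a * b ∈ ℬ (g * h))
    (deg : Fin n → G) (T : Fin n → FreeAlgebra K (Fin n)) (C : FreeAlgebra K (Fin n))
    (P : MvPolynomial (Fin n × Fin n × Fin n) K) :
    ∃ N W, Represents 𝒜 deg T C N P W ∧ Represents ℬ deg T C N P W := by
  induction P using MvPolynomial.induction_on with
  | C c => exact ⟨0, _, .const c, .const c⟩
  | add P Q hP hQ =>
    obtain ⟨N, W, hW, hW'⟩ := hP
    obtain ⟨m, V, hV, hV'⟩ := hQ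
    exact ⟨m + N, _, (hW.pow_altOp m).add (add_comm N m ▸ hV.pow_altOp N),
      (hW'.pow_altOp m).add (add_comm N m ▸ hV'.pow_altOp N)⟩
  | mul_X P t hP =>
    obtain ⟨N, W, hW, hW'⟩ := hP
    obtain ⟨i, j, k⟩ := t
    exact ⟨N + 1, _, hW.mul_X h𝒜 i j k, hW'.mul_X hℬ i j k⟩

theorem exists_altOp_pow_ne_zero
    (hPI : ∀ f : FreeNonUnitalNonAssocAlgebra K (ℕ × G), IsGradedPI ℬ f → IsGradedPI 𝒜 f)
    {deg : Fin n → G} {b : Fin n → A} (hb : ∀ i, b i ∈ 𝒜 (deg i))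
    {T : Fin n → FreeAlgebra K (Fin n)} {C : FreeAlgebra K (Fin n)} {h : G} {v : A}
    (hv : v ∈ 𝒜 h) (hv0 : v ≠ 0) (hfix : altOp deg T C b b v = v) (N : ℕ) :
    ∃ (z y : Fin n → B) (x : B), (∀ i, z i ∈ ℬ (deg i)) ∧ (∀ i, y i ∈ ℬ (deg i)) ∧ x ∈ ℬ h ∧
      (altOp deg T C z y ^ N) x ≠ 0 := by
  have hpow : ∀ m, (altOp deg T C b b ^ m) v = v := fun m => by
    induction m with
    | zero => simp
    | succ m ih => rw [pow_succ, Module.End.mul_apply, hfix, ih]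
  by_contra! hcon
  have key := lift_eq_zero_of_isGradedPI_imp hPI (OpVar.assign deg deg h)
    ((altOp deg T C (fun i => OpVar.X K (.inl i)) (fun i => OpVar.X K (.inr (.inl i))) ^ N)
      (OpVar.X K (.inr (.inr ()))))
    (fun e he => by
      rw [OpVar.assign_eq e, lift_altOp_pow, FreeNonUnitalNonAssocAlgebra.lift_of_apply]
      exact hcon _ _ _ (fun i => he (.inl i)) (fun i => he (.inr (.inl i))) (he (.inr (.inr ()))))
    (OpVar.assign b b v) (OpVar.assign_mem hb hb hv)
  rw [lift_altOp_pow, FreeNonUnitalNonAssocAlgebra.lift_of_apply] at key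
  exact hv0 ((hpow N).symm.trans key)

/-- Polynomial relations between structure constants in homogeneous bases are determined by the
graded identities. -/
theorem eval_structConst_eq_zero [Mul G] [DirectSum.Decomposition 𝒜] [DirectSum.Decomposition ℬ]
    (h𝒜 : ∀ g h : G, ∀ a ∈ 𝒜 g, ∀ b ∈ 𝒜 h, a * b ∈ 𝒜 (g * h))
    (hℬ : ∀ g h : G, ∀ a ∈ ℬ g, ∀ b ∈ ℬ h, a * b ∈ ℬ (g * h))
    (hPI : ∀ f : FreeNonUnitalNonAssocAlgebra K (ℕ × G), IsGradedPI 𝒜 f ↔ IsGradedPI ℬ f)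
    {deg : Fin n → G} (b : HomogeneousBasis 𝒜 deg)
    {T : Fin n → FreeAlgebra K (Fin n)} {C : FreeAlgebra K (Fin n)} {h : G} {v : A}
    (hv : v ∈ 𝒜 h) (hv0 : v ≠ 0) (hfix : altOp deg T C b.1 b.1 v = v)
    (P : MvPolynomial (Fin n × Fin n × Fin n) K)
    (hP : ∀ y : HomogeneousBasis 𝒜 deg,
      MvPolynomial.eval (fun t => HomogeneousBasis.structConst t y) P = 0)
    (y : HomogeneousBasis ℬ deg) :
    MvPolynomial.eval (fun t => HomogeneousBasis.structConst t y) P = 0 := by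
  have := Module.Finite.of_basis b.1
  obtain ⟨N, W, hW, hW'⟩ := exists_represents h𝒜 hℬ deg T C P
  obtain ⟨z, u, x, hz, hu, hx, hne⟩ :=
    exists_altOp_pow_ne_zero (fun f => (hPI f).2) b.2 hv hv0 hfix (1 + N)
  have key := lift_eq_zero_of_isGradedPI_imp (fun f => (hPI f).1) (OpVar.assign deg deg h)
    ((altOp deg T C (fun i => OpVar.X K (.inl i)) (fun i => OpVar.X K (.inr (.inl i))) ^ 1) W)
    (fun e he => by
      rw [OpVar.assign_eq e]
      have hy : ∀ i, (e ∘ Sum.inr ∘ Sum.inl) i ∈ 𝒜 (deg i) := fun i => he (.inr (.inl i))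
      generalize e ∘ Sum.inr ∘ Sum.inl = y at hy ⊢
      by_cases hli : LinearIndependent K y
      · let Y := basisOfLinearIndependentOfCardEqFinrank' y hli
          (Module.finrank_eq_card_basis b.1).symm
        have hY : (Y : Fin n → A) = y := coe_basisOfLinearIndependentOfCardEqFinrank' ..
        have := hW.pow_altOp 1 (e ∘ Sum.inl) ⟨Y, hY ▸ hy⟩ (e (.inr (.inr ())))
        rw [hP, zero_smul] at this
        rwa [hY] at this
      · rw [lift_altOp_pow, altOp_eq_zero T C _ hy hli]
        simp)
    (OpVar.assign z y.1 x) (OpVar.assign_mem hz y.2 hx)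
  rw [hW'.pow_altOp 1 z y x, smul_eq_zero] at key
  refine key.resolve_right fun h0 => hne ?_
  obtain ⟨c, hc⟩ := exists_altOp_eq_smul T C z y hu
  rw [hc, smul_pow, LinearMap.smul_apply, h0, smul_zero]

end Transfer

theorem exists_homogeneousBasis {K G A : Type*} [Field K] [DecidableEq G]
    [NonUnitalNonAssocRing A] [Module K A] [FiniteDimensional K A] (𝒜 : G → Submodule K A)
    [DirectSum.Decomposition 𝒜] :
    ∃ deg : Fin (Module.finrank K A) → G, Nonempty (HomogeneousBasis 𝒜 deg) := by
  have hint := DirectSum.Decomposition.isInternal 𝒜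
  let c := hint.collectedBasis fun g => Module.Basis.ofVectorSpace K (𝒜 g)
  have := Module.Finite.finite_basis c
  have := Fintype.ofFinite
    ((g : G) × Module.Basis.ofVectorSpaceIndex K (𝒜 g))
  let e := Fintype.equivFinOfCardEq (Module.finrank_eq_card_basis c).symm
  refine ⟨fun i => (e.symm i).1, ⟨c.reindex e, fun i => ?_⟩⟩
  rw [Module.Basis.reindex_apply]
  exact hint.collectedBasis_mem _ _

theorem exists_linearIndependent_homogeneous {K G A B : Type*} [Field K] [IsAlgClosed K]
    [CommGroup G] [DecidableEq G]
    [NonUnitalNonAssocRing A] [Module K A] [SMulCommClass K A A] [IsScalarTower K A A]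
    [FiniteDimensional K A]
    [NonUnitalNonAssocRing B] [Module K B] [SMulCommClass K B B] [IsScalarTower K B B]
    {ε : G → G → Kˣ} {𝒜 : G → Submodule K A} [DirectSum.Decomposition 𝒜]
    {ℬ : G → Submodule K B} [DirectSum.Decomposition ℬ]
    (hA : IsColourLieSuperalgebra ε 𝒜) (hs : IsGradedSimple 𝒜)
    (hPI : ∀ f : FreeNonUnitalNonAssocAlgebra K (ℕ × G), IsGradedPI ℬ f → IsGradedPI 𝒜 f)
    {n : ℕ} {deg : Fin n → G} (b : HomogeneousBasis 𝒜 deg) :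
    ∃ y : Fin n → B, (∀ i, y i ∈ ℬ (deg i)) ∧ LinearIndependent K y := by
  obtain ⟨T, C, h, v, hv, hv0, hfix⟩ := exists_altOp_eigenvector hA hs b
  obtain ⟨z, y, x, -, hy, -, hne⟩ := exists_altOp_pow_ne_zero hPI b.2 hv hv0 hfix 1
  refine ⟨y, hy, ?_⟩
  by_contra hli
  rw [altOp_eq_zero T C z hy hli] at hne
  simp at hne

theorem colourLie_same_identities_isomorphic
    (K G L M : Type*) [Field K] [IsAlgClosed K] [CommGroup G] [DecidableEq G]
    (ε : G → G → Kˣ)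
    (hbi1 : ∀ g h k : G, ε (g * h) k = ε g k * ε h k)
    (hbi2 : ∀ g h k : G, ε g (h * k) = ε g h * ε g k)
    (halt : ∀ g h : G, ε g h * ε h g = 1)
    [NonUnitalNonAssocRing L] [Module K L] [SMulCommClass K L L] [IsScalarTower K L L]
    [FiniteDimensional K L]
    [NonUnitalNonAssocRing M] [Module K M] [SMulCommClass K M M] [IsScalarTower K M M]
    [FiniteDimensional K M]
    (𝒜 : G → Submodule K L) [DirectSum.Decomposition 𝒜]
    (ℬ : G → Submodule K M) [DirectSum.Decomposition ℬ]
    (hL : IsColourLieSuperalgebra ε 𝒜) (hM : IsColourLieSuperalgebra ε ℬ)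
    (hLs : IsGradedSimple 𝒜) (hMs : IsGradedSimple ℬ)
    (hsame : ∀ f : FreeNonUnitalNonAssocAlgebra K (ℕ × G),
      IsGradedPI 𝒜 f ↔ IsGradedPI ℬ f) :
    IsGradedIso 𝒜 ℬ := by
  obtain ⟨deg, ⟨b⟩⟩ := exists_homogeneousBasis 𝒜
  obtain ⟨deg', ⟨c⟩⟩ := exists_homogeneousBasis ℬ
  obtain ⟨y, hy, hli⟩ := exists_linearIndependent_homogeneous hL hLs (fun f => (hsame f).2) b
  obtain ⟨y', -, hli'⟩ := exists_linearIndependent_homogeneous hM hMs (fun f => (hsame f).1) c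
  have hle : Module.finrank K L ≤ Module.finrank K M := by simpa using hli.fintype_card_le_finrank
  have hge : Module.finrank K M ≤ Module.finrank K L := by simpa using hli'.fintype_card_le_finrank
  have hcard : Fintype.card (Fin (Module.finrank K L)) = Module.finrank K M := by
    rw [Fintype.card_fin]; exact le_antisymm hle hge
  let Y := basisOfLinearIndependentOfCardEqFinrank' y hli hcard
  have hY : (Y : Fin _ → M) = y := coe_basisOfLinearIndependentOfCardEqFinrank' ..
  let b' : HomogeneousBasis ℬ deg := ⟨Y, hY ▸ hy⟩
  obtain ⟨T, C, h, v, hv, hv0, hfix⟩ := exists_altOp_eigenvector hL hLs b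
  obtain ⟨T', C', h', v', hv', hv0', hfix'⟩ := exists_altOp_eigenvector hM hMs b'
  have : Nonempty (HomogeneousBasis 𝒜 deg) := ⟨b⟩
  obtain ⟨χ, ψ, hχ⟩ := exists_algHom_adjoin_eq
    HomogeneousBasis.structConst HomogeneousBasis.structConst
    b.coordFunctions b'.coordFunctions b.finite_coordFunctions b'.finite_coordFunctions
    b.structConst_mem b'.structConst_mem
    fun P => ⟨eval_structConst_eq_zero hL.1 hM.1 hsame b hv hv0 hfix P,
      eval_structConst_eq_zero hM.1 hL.1 (fun f => (hsame f).symm) b' hv' hv0' hfix' P⟩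
  obtain ⟨s, hs⟩ := b.exists_structConst_eq χ
  obtain ⟨s', hs'⟩ := b'.exists_structConst_eq ψ
  exact HomogeneousBasis.isGradedIso_of_structConst_eq s s' fun t => by rw [hs, hs', hχ]
end

section
/- Let K be an algebraically closed field. Let A₁ = M_{n₁}(K) × … × M_{n_r}(K) and A₂ = M_{n'₁}(K) × … × M_{n'_s}(K), equipped with the traces tr(a₁,…,a_r) = (∑ᵢ Tr(aᵢ)) · 1 induced from the embedding as block-diagonal matrices (here Tr is the usual matrix trace and 1 is the identity of the product algebra). If the multiset {n₁,…,n_r} is different from the multiset {n'₁,…,n'_s}, then A₁ and A₂ do not satisfy the same trace polynomial identities: there is a trace polynomial identity of one of them that is not a trace polynomial identity of the other. -/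
/-!
STATEMENT 13: Let K be an algebraically closed field. Let A₁ = M_{n₁}(K) × … × M_{n_r}(K)
and A₂ = M_{n'₁}(K) × … × M_{n'_s}(K), equipped with the traces
tr(a₁,…,a_r) = (∑ᵢ Tr(aᵢ)) · 1 induced from the embedding as block-diagonal matrices.
If the multiset {n₁,…,n_r} is different from the multiset {n'₁,…,n'_s}, then A₁ and A₂
do not satisfy the same trace polynomial identities: there is a trace polynomial identity
of one of them that is not a trace polynomial identity of the other.
-/

/-- Terms over the signature `Ω_tr = {μ, tr}` in the variables `X = ℕ`:
one binary function symbol `μ` and one unary function symbol `tr`. -/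
inductive TraceTerm where
  | var : ℕ → TraceTerm
  | tr : TraceTerm → TraceTerm
  | mu : TraceTerm → TraceTerm → TraceTerm

/-- The realization `t^A(v)` of a trace term `t` in `A` under the evaluation `v` of the
variables, interpreting `μ` as the multiplication of `A` and `tr` as the map `trA`. -/
def TraceTerm.eval {A : Type*} [Mul A] (trA : A → A) (v : ℕ → A) : TraceTerm → A
  | var n => v n
  | tr t => trA (t.eval trA v)
  | mu s t => s.eval trA v * t.eval trA v

/-- `f`, a finitely supported `K`-linear combination of trace terms (a trace polynomial),
is a trace polynomial identity of `(A, trA)`. -/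
def IsTracePI {K A : Type*} [Field K] [Ring A] [Module K A]
    (trA : A → A) (f : TraceTerm →₀ K) : Prop :=
  ∀ v : ℕ → A, (f.sum fun t c => c • TraceTerm.eval trA v t) = 0

section TraceFunctions

variable {K P : Type*} [Field K] {A : P → Type*} [∀ p, Ring (A p)] [∀ p, Algebra K (A p)]

/-- The functions on a family of evaluation points `v p : ℕ → A p` of algebras with traces
`τ p` which are realized by trace polynomials. -/
def traceFunctions (τ : ∀ p, A p →ₗ[K] K) (v : ∀ p, ℕ → A p) : Submodule K (∀ p, A p) :=
  Submodule.span K (Set.range fun (t : TraceTerm) p => t.eval (fun a => τ p a • 1) (v p))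

variable {τ : ∀ p, A p →ₗ[K] K} {v : ∀ p, ℕ → A p}

theorem exists_finsupp_of_mem_traceFunctions {F : ∀ p, A p} (hF : F ∈ traceFunctions τ v) :
    ∃ f : TraceTerm →₀ K,
      ∀ p, (f.sum fun t c => c • t.eval (fun a => τ p a • 1) (v p)) = F p := by
  obtain ⟨f, hf⟩ := (Finsupp.mem_span_range_iff_exists_finsupp).1 hF
  refine ⟨f, fun p => ?_⟩
  rw [← hf, Finsupp.sum, Finsupp.sum, Finset.sum_apply]
  rfl

theorem var_mem_traceFunctions (k : ℕ) : (fun p => v p k) ∈ traceFunctions τ v :=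
  Submodule.subset_span ⟨.var k, rfl⟩

theorem mul_mem_traceFunctions {F G : ∀ p, A p} (hF : F ∈ traceFunctions τ v)
    (hG : G ∈ traceFunctions τ v) : F * G ∈ traceFunctions τ v := by
  have h := Submodule.mul_mem_mul hF hG
  rw [traceFunctions, Submodule.span_mul_span] at h
  refine Submodule.span_mono ?_ h
  rintro _ ⟨_, ⟨s, rfl⟩, _, ⟨t, rfl⟩, rfl⟩
  exact ⟨.mu s t, rfl⟩

theorem mul_list_prod_mem_traceFunctions {F : ∀ p, A p} (hF : F ∈ traceFunctions τ v)
    (l : List (∀ p, A p)) (hl : ∀ G ∈ l, G ∈ traceFunctions τ v) :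
    F * l.prod ∈ traceFunctions τ v := by
  induction l generalizing F with
  | nil => simpa using hF
  | cons G l ih =>
    rw [List.prod_cons, ← mul_assoc]
    exact ih (mul_mem_traceFunctions hF (hl G (by simp))) fun H hH => hl H (by simp [hH])

/-- The scalar-valued functions whose multiples of trace functions are trace functions. -/
def scalarTraceFunctions (τ : ∀ p, A p →ₗ[K] K) (v : ∀ p, ℕ → A p) : Subalgebra K (P → K) where
  carrier := {φ | ∀ F ∈ traceFunctions τ v, (fun p => φ p • F p) ∈ traceFunctions τ v}
  mul_mem' {φ ψ} hφ hψ F hF := by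
    simpa only [Pi.mul_apply, mul_smul] using hφ _ (hψ F hF)
  add_mem' {φ ψ} hφ hψ F hF := by
    simp only [Pi.add_apply, add_smul]
    exact add_mem (hφ F hF) (hψ F hF)
  algebraMap_mem' c F hF := Submodule.smul_mem _ c hF

theorem trace_mem_scalarTraceFunctions {F : ∀ p, A p} (hF : F ∈ traceFunctions τ v) :
    (fun p => τ p (F p)) ∈ scalarTraceFunctions τ v := by
  intro G hG
  have h1 : (fun p => τ p (F p) • (1 : A p)) ∈ traceFunctions τ v := by
    let L : (∀ p, A p) →ₗ[K] (∀ p, A p) :=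
      LinearMap.pi fun p => ((τ p).smulRight (1 : A p)).comp (LinearMap.proj p)
    have hL : traceFunctions τ v ≤ (traceFunctions τ v).comap L := by
      refine Submodule.span_le.2 ?_
      rintro _ ⟨t, rfl⟩
      exact Submodule.subset_span ⟨.tr t, rfl⟩
    exact hL hF
  convert mul_mem_traceFunctions h1 hG using 1
  ext p
  simp

theorem det_mem_scalarTraceFunctions {N : ℕ} (M : Fin N → Fin N → P → K)
    (hM : ∀ i j, M i j ∈ scalarTraceFunctions τ v) :
    (fun p => Matrix.det (Matrix.of fun i j => M i j p)) ∈ scalarTraceFunctions τ v := by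
  have h : (fun p => Matrix.det (Matrix.of fun i j => M i j p)) = Matrix.det (Matrix.of M) := by
    ext p
    simp [Matrix.det_apply, Finset.sum_apply]
  rw [h, Matrix.det_apply]
  refine sum_mem fun σ _ => ?_
  rw [Units.smul_def]
  exact zsmul_mem (prod_mem fun i _ => hM _ _) _

end TraceFunctions

section Capelli

/-- The Capelli polynomial `∑ σ, sgn σ • y x_{σ 0} w_0 x_{σ 1} w_1 ⋯`. -/
def capelli {A : Type*} [Ring A] {d : ℕ} (y : A) (x w : Fin d → A) : A :=
  ∑ σ : Equiv.Perm (Fin d), Equiv.Perm.sign σ • (y * (List.ofFn fun i => x (σ i) * w i).prod)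

theorem map_capelli {A B : Type*} [Ring A] [Ring B] (f : A →+* B) {d : ℕ} (y : A)
    (x w : Fin d → A) : f (capelli y x w) = capelli (f y) (fun i => f (x i)) fun i => f (w i) := by
  simp [capelli, Units.smul_def, map_list_prod, List.map_ofFn, Function.comp_def]

theorem capelli_apply {ι : Type*} {A : ι → Type*} [∀ i, Ring (A i)] {d : ℕ} (y : ∀ i, A i)
    (x w : Fin d → ∀ i, A i) (i : ι) :
    capelli y x w i = capelli (y i) (fun l => x l i) fun l => w l i :=
  map_capelli (Pi.evalRingHom A i) y x w

theorem capelli_mem_traceFunctions {K P : Type*} [Field K] {A : P → Type*} [∀ p, Ring (A p)]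
    [∀ p, Algebra K (A p)] {τ : ∀ p, A p →ₗ[K] K} {v : ∀ p, ℕ → A p} {d : ℕ}
    {y : ∀ p, A p} {x w : Fin d → ∀ p, A p} (hy : y ∈ traceFunctions τ v)
    (hx : ∀ i, x i ∈ traceFunctions τ v) (hw : ∀ i, w i ∈ traceFunctions τ v) :
    capelli y x w ∈ traceFunctions τ v := by
  refine sum_mem fun σ _ => ?_
  rw [Units.smul_def]
  refine zsmul_mem (mul_list_prod_mem_traceFunctions hy _ fun G hG => ?_) _
  obtain ⟨i, rfl⟩ := List.mem_ofFn.1 hG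
  exact mul_mem_traceFunctions (hx _) (hw _)

theorem capelli_eq_zero_of_finrank_lt (K : Type*) {A : Type*} [Field K] [Ring A] [Algebra K A]
    [Module.Finite K A] {d : ℕ} (hd : Module.finrank K A < d) (y : A) (x w : Fin d → A) :
    capelli y x w = 0 := by
  have hx : ¬ LinearIndependent K x := fun h =>
    hd.not_ge (by simpa using h.fintype_card_le_finrank)
  have h := (MultilinearMap.alternatization
    ((LinearMap.mulLeft K y).compMultilinearMap ((MultilinearMap.mkPiAlgebraFin K d A).compLinearMap
      fun i => LinearMap.mulRight K (w i)))).map_linearDependent x hx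
  rw [MultilinearMap.alternatization_apply] at h
  simpa [capelli, MultilinearMap.domDomCongr_apply] using h

theorem single_mul_prod_single {R : Type*} [Ring R] {n d : ℕ} (p : Fin n) (α : Fin (d + 1) → Fin n)
    (a b β : Fin d → Fin n) :
    Matrix.single p (α 0) (1 : R) * (List.ofFn fun i =>
      Matrix.single (a i) (b i) (1 : R) * Matrix.single (β i) (α i.succ) 1).prod =
    if ∀ i, a i = α i.castSucc ∧ b i = β i then Matrix.single p (α (Fin.last d)) 1 else 0 := by
  induction d with
  | zero => simp
  | succ d ih =>
    rw [List.ofFn_succ, List.prod_cons, ← mul_assoc, ← mul_assoc]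
    by_cases ha : a 0 = α 0
    · by_cases hb : b 0 = β 0
      · have := ih (fun i => α i.succ) (fun i => a i.succ) (fun i => b i.succ) fun i => β i.succ
        simp only [Fin.succ_zero_eq_one] at this
        simp [ha, hb, Fin.forall_fin_succ, this]
      · rw [mul_assoc (Matrix.single p _ _), Matrix.single_mul_single_of_ne (h := hb)]
        rw [if_neg fun h => hb (h 0).2]
        simp
    · rw [Matrix.single_mul_single_of_ne (h := fun h => ha h.symm),
        if_neg fun h => ha (h 0).1]
      simp

theorem exists_capelli_eq_single (R : Type*) [Ring R] {n d : ℕ} (hd : d ≤ n * n) (p q : Fin n) :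
    ∃ (y : Matrix (Fin n) (Fin n) R) (x w : Fin d → Matrix (Fin n) (Fin n) R),
      capelli y x w = Matrix.single p q 1 := by
  obtain ⟨e⟩ : Nonempty (Fin d ↪ Fin n × Fin n) :=
    Function.Embedding.nonempty_of_card_le (by simpa using hd)
  let α : Fin (d + 1) → Fin n := Fin.snoc (α := fun _ => Fin n) (fun i => (e i).1) q
  have hα : ∀ i : Fin d, α i.castSucc = (e i).1 := fun i => Fin.snoc_castSucc ..
  have hq : α (Fin.last d) = q := Fin.snoc_last ..
  refine ⟨Matrix.single p (α 0) 1, fun i => Matrix.single (e i).1 (e i).2 1,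
    fun i => Matrix.single (e i).2 (α i.succ) 1, ?_⟩
  rw [capelli, Finset.sum_eq_single 1]
  · rw [single_mul_prod_single p α (fun i => (e ((1 : Equiv.Perm (Fin d)) i)).1)
      (fun i => (e ((1 : Equiv.Perm (Fin d)) i)).2) fun i => (e i).2]
    simp [hα, hq]
  · intro σ _ hσ
    rw [single_mul_prod_single p α (fun i => (e (σ i)).1) (fun i => (e (σ i)).2) fun i => (e i).2,
      if_neg, smul_zero]
    intro h
    refine hσ (Equiv.ext fun i => e.injective (Prod.ext ?_ (h i).2))
    rw [(h i).1, hα]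
    rfl
  · simp

end Capelli

section MatrixProducts

variable {K : Type*} [Field K] {r : ℕ} {n : Fin r → ℕ}

/-- The sum of the matrix traces on a product of matrix algebras. -/
def sumTrace (K : Type*) [Field K] {r : ℕ} (n : Fin r → ℕ) :
    (∀ i : Fin r, Matrix (Fin (n i)) (Fin (n i)) K) →ₗ[K] K :=
  ∑ i, (Matrix.traceLinearMap (Fin (n i)) K K).comp (LinearMap.proj i)

theorem sumTrace_apply (a : ∀ i : Fin r, Matrix (Fin (n i)) (Fin (n i)) K) :
    sumTrace K n a = ∑ i, Matrix.trace (a i) := by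
  simp [sumTrace, LinearMap.sum_apply]

/-- The positions of the matrix entries in the blocks of size larger than `k`. -/
abbrev LargeBlockEntry (n : Fin r → ℕ) (k : ℕ) : Type :=
  Σ i : {i // k < n i}, Fin (n i) × Fin (n i)

theorem sumTrace_mul {k : ℕ} (u t : ∀ i : Fin r, Matrix (Fin (n i)) (Fin (n i)) K)
    (hu : ∀ i, n i ≤ k → u i = 0) :
    sumTrace K n (u * t) =
      ∑ c : LargeBlockEntry n k, u c.1 c.2.1 c.2.2 * t c.1 c.2.2 c.2.1 := by
  have h : ∀ i ∈ Finset.univ, Matrix.trace ((u * t) i) ≠ 0 → k < n i := fun i _ hi => by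
    by_contra! hk
    simp [hu i hk] at hi
  rw [sumTrace_apply, Fintype.sum_sigma, ← Finset.sum_filter_of_ne h,
    Finset.sum_subtype _ (p := fun i => k < n i) (by simp)]
  refine Finset.sum_congr rfl fun i _ => ?_
  simp [Matrix.trace, Matrix.mul_apply, Fintype.sum_prod_type]

theorem det_sumTrace_mul_eq_zero {k N : ℕ} (hN : Fintype.card (LargeBlockEntry n k) < N)
    (u t : Fin N → ∀ i : Fin r, Matrix (Fin (n i)) (Fin (n i)) K)
    (hu : ∀ l i, n i ≤ k → u l i = 0) :
    Matrix.det (Matrix.of fun l m => sumTrace K n (u l * t m)) = 0 := by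
  let U : Matrix (Fin N) (LargeBlockEntry n k) K := Matrix.of fun l c => u l c.1 c.2.1 c.2.2
  let T : Matrix (LargeBlockEntry n k) (Fin N) K := Matrix.of fun c m => t m c.1 c.2.2 c.2.1
  have h : (Matrix.of fun l m => sumTrace K n (u l * t m)) = U * T := by
    ext l m
    simp [U, T, Matrix.mul_apply, sumTrace_mul (u l) (t m) (hu l)]
  rw [h]
  by_contra hdet
  have h1 := Matrix.rank_of_isUnit (U * T) ((Matrix.isUnit_iff_isUnit_det _).2 (Ne.isUnit hdet))
  have h2 := (Matrix.rank_mul_le_left U T).trans U.rank_le_card_width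
  rw [h1, Fintype.card_fin] at h2
  omega

theorem capelli_apply_eq_zero {k d : ℕ} (hd : k * k < d)
    (y : ∀ i : Fin r, Matrix (Fin (n i)) (Fin (n i)) K)
    (x w : Fin d → ∀ i : Fin r, Matrix (Fin (n i)) (Fin (n i)) K)
    (i : Fin r) (hi : n i ≤ k) : capelli y x w i = 0 := by
  rw [capelli_apply]
  refine capelli_eq_zero_of_finrank_lt K ?_ _ _ _
  simpa [Module.finrank_matrix] using (Nat.mul_le_mul hi hi).trans_lt hd

/-- The matrix unit of the product algebra at a given position. -/
def blockUnit (K : Type*) [Field K] {r : ℕ} {n : Fin r → ℕ} {k : ℕ} (c : LargeBlockEntry n k) :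
    ∀ i : Fin r, Matrix (Fin (n i)) (Fin (n i)) K :=
  Pi.single c.1.1 (Matrix.single c.2.1 c.2.2 1)

theorem exists_capelli_eq_blockUnit {k d : ℕ} (hd : d ≤ (k + 1) * (k + 1))
    (c : LargeBlockEntry n k) :
    ∃ (y : ∀ i : Fin r, Matrix (Fin (n i)) (Fin (n i)) K)
      (x w : Fin d → ∀ i : Fin r, Matrix (Fin (n i)) (Fin (n i)) K),
      capelli y x w = blockUnit K c := by
  obtain ⟨⟨j, hj⟩, p, q⟩ := c
  obtain ⟨y, x, w, h⟩ := exists_capelli_eq_single K (n := n j) (d := d)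
    (hd.trans (Nat.mul_le_mul hj hj)) p q
  refine ⟨Pi.single j y, fun l => Pi.single j (x l), fun l => Pi.single j (w l), ?_⟩
  ext1 i
  rw [capelli_apply]
  obtain rfl | hij := eq_or_ne i j
  · simpa only [blockUnit, Pi.single_eq_same] using h
  · simp [blockUnit, capelli, Pi.single_eq_of_ne hij]

theorem exists_sumTrace_blockUnit_mul {k : ℕ} (c : LargeBlockEntry n k) :
    ∃ t : ∀ i : Fin r, Matrix (Fin (n i)) (Fin (n i)) K,
      ∀ c' : LargeBlockEntry n k, sumTrace K n (blockUnit K c' * t) = if c' = c then 1 else 0 := by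
  obtain ⟨⟨j, hj⟩, p, q⟩ := c
  refine ⟨Pi.single j (Matrix.single q p 1), ?_⟩
  rintro ⟨⟨j', hj'⟩, p', q'⟩
  rw [sumTrace_apply, Finset.sum_eq_single j]
  · obtain rfl | hij := eq_or_ne j' j
    · simp [blockUnit, Matrix.trace_mul_single, Matrix.single_apply]
    · simp [blockUnit, hij]
  · intro i _ hi
    simp [Pi.single_eq_of_ne hi]
  · simp

theorem card_largeBlockEntry (n : Fin r → ℕ) (k : ℕ) :
    Fintype.card (LargeBlockEntry n k) = ∑ i, if k < n i then n i * n i else 0 := by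
  rw [← Finset.sum_filter,
    Finset.sum_subtype _ (p := fun i => k < n i) (F := inferInstance) (by simp)]
  simp

theorem card_largeBlockEntry_eq_add (n : Fin r → ℕ) (k : ℕ) :
    Fintype.card (LargeBlockEntry n k) = Fintype.card (LargeBlockEntry n (k + 1)) +
      (Finset.univ.val.map n).count (k + 1) * ((k + 1) * (k + 1)) := by
  have h : (Finset.univ.val.map n).count (k + 1) * ((k + 1) * (k + 1)) =
      ∑ i, if k + 1 = n i then (k + 1) * (k + 1) else 0 := by
    rw [Multiset.count_map, ← Finset.sum_filter, Finset.sum_const, smul_eq_mul]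
    rfl
  rw [h, card_largeBlockEntry, card_largeBlockEntry, ← Finset.sum_add_distrib]
  refine Finset.sum_congr rfl fun i _ => ?_
  rcases lt_trichotomy (k + 1) (n i) with h | h | h
  · simp [h, h.ne, (Nat.lt_succ_self k).trans h]
  · simp [← h]
  · simp [h.not_gt, h.ne', (Nat.lt_succ_iff.1 h).not_gt]

theorem map_eq_of_card_largeBlockEntry_eq {s : ℕ} {n' : Fin s → ℕ} (hpos : ∀ i, 1 ≤ n i)
    (hpos' : ∀ j, 1 ≤ n' j) (h : ∀ k, Fintype.card (LargeBlockEntry n k) =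
      Fintype.card (LargeBlockEntry n' k)) :
    (Finset.univ.val.map n : Multiset ℕ) = Finset.univ.val.map n' := by
  refine Multiset.ext.2 fun a => ?_
  cases a with
  | zero =>
    rw [Multiset.count_eq_zero_of_notMem, Multiset.count_eq_zero_of_notMem]
    · simpa using fun j => Nat.one_le_iff_ne_zero.1 (hpos' j)
    · simpa using fun i => Nat.one_le_iff_ne_zero.1 (hpos i)
  | succ k =>
    have h1 := card_largeBlockEntry_eq_add n k
    rw [h k, h (k + 1), card_largeBlockEntry_eq_add n' k] at h1
    exact (Nat.eq_of_mul_eq_mul_right (by positivity) (Nat.add_left_cancel h1)).symm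

end MatrixProducts

/-- The variables of the trace polynomial `det (tr (capelli yₗ xₗ wₗ * tₘ)) • z`. -/
abbrev GramVar (N d : ℕ) : Type :=
  Unit ⊕ Fin N ⊕ Fin N ⊕ (Fin N × Fin d) ⊕ (Fin N × Fin d)

/-- The trace polynomial `det (tr (capelli yₗ xₗ wₗ * tₘ)) • z`. -/
theorem exists_finsupp_sum_eq_det_smul {K P : Type*} [Field K] {A : P → Type*} [∀ p, Ring (A p)]
    [∀ p, Algebra K (A p)] (τ : ∀ p, A p →ₗ[K] K) (v : ∀ p, ℕ → A p) {N d : ℕ}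
    (enc : GramVar N d → ℕ) :
    ∃ f : TraceTerm →₀ K, ∀ p,
      let X : GramVar N d → A p := fun c => v p (enc c)
      (f.sum fun t c => c • t.eval (fun a => τ p a • 1) (v p)) =
        Matrix.det (Matrix.of fun l m => τ p (capelli (X (.inr (.inl l)))
          (fun i => X (.inr (.inr (.inr (.inl (l, i))))))
          (fun i => X (.inr (.inr (.inr (.inr (l, i)))))) * X (.inr (.inr (.inl m))))) •
            X (.inl ()) := by
  let X : GramVar N d → ∀ p, A p := fun c p => v p (enc c)
  have hX : ∀ c, X c ∈ traceFunctions τ v := fun c => var_mem_traceFunctions _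
  let u : Fin N → ∀ p, A p := fun l => capelli (X (.inr (.inl l)))
    (fun i => X (.inr (.inr (.inr (.inl (l, i)))))) fun i => X (.inr (.inr (.inr (.inr (l, i)))))
  have hu : ∀ l, u l ∈ traceFunctions τ v := fun l =>
    capelli_mem_traceFunctions (hX _) (fun _ => hX _) fun _ => hX _
  have hdet := det_mem_scalarTraceFunctions (fun l m p => τ p ((u l * X (.inr (.inr (.inl m)))) p))
    fun l m => trace_mem_scalarTraceFunctions (mul_mem_traceFunctions (hu l) (hX _))
  obtain ⟨f, hf⟩ := exists_finsupp_of_mem_traceFunctions (hdet _ (hX (.inl ())))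
  refine ⟨f, fun p => (hf p).trans ?_⟩
  simp only [Pi.mul_apply, u, capelli_apply]
  rfl

/-- If `n` has fewer entries than `n'` in blocks of size larger than `k`, some trace identity of the
product algebra of `n` fails for that of `n'`. -/
theorem exists_isTracePI_of_card_largeBlockEntry_lt (K : Type*) [Field K] {r s k : ℕ}
    {n : Fin r → ℕ} {n' : Fin s → ℕ}
    (h : Fintype.card (LargeBlockEntry n k) < Fintype.card (LargeBlockEntry n' k)) :
    ∃ f : TraceTerm →₀ K,
      IsTracePI (A := ∀ i : Fin r, Matrix (Fin (n i)) (Fin (n i)) K)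
          (fun a => (∑ i, Matrix.trace (a i)) • 1) f ∧
        ¬ IsTracePI (A := ∀ j : Fin s, Matrix (Fin (n' j)) (Fin (n' j)) K)
          (fun a => (∑ j, Matrix.trace (a j)) • 1) f := by
  obtain ⟨d, hd, hd'⟩ : ∃ d, k * k < d ∧ d ≤ (k + 1) * (k + 1) :=
    ⟨k * k + 1, by omega, by nlinarith⟩
  obtain ⟨enc, henc⟩ : ∃ enc : GramVar (Fintype.card (LargeBlockEntry n k) + 1) d → ℕ,
    Function.Injective enc := ⟨_, Encodable.encode_injective⟩
  obtain ⟨f, hf⟩ := exists_finsupp_sum_eq_det_smul (K := K)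
    (P := Σ m : Σ r : ℕ, Fin r → ℕ, ℕ → ∀ i : Fin m.1, Matrix (Fin (m.2 i)) (Fin (m.2 i)) K)
    (A := fun p => ∀ i : Fin p.1.1, Matrix (Fin (p.1.2 i)) (Fin (p.1.2 i)) K)
    (fun p => sumTrace K p.1.2) (fun p => p.2) enc
  refine ⟨f, fun a => ?_, fun hid => ?_⟩
  · have h1 := hf ⟨⟨r, n⟩, a⟩
    simp only [sumTrace_apply] at h1
    refine h1.trans ?_
    simp only [← sumTrace_apply]
    have h0 := det_sumTrace_mul_eq_zero (K := K) (n := n) (k := k)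
      (Nat.lt_succ_self _) (fun l => capelli (a (enc (.inr (.inl l))))
        (fun i => a (enc (.inr (.inr (.inr (.inl (l, i)))))))
        fun i => a (enc (.inr (.inr (.inr (.inr (l, i)))))))
      (fun m => a (enc (.inr (.inr (.inl m)))))
      fun l i hi => capelli_apply_eq_zero hd _ _ _ i hi
    rw [h0, zero_smul]
  · obtain ⟨e⟩ : Nonempty (Fin (Fintype.card (LargeBlockEntry n k) + 1) ↪ LargeBlockEntry n' k) :=
      Function.Embedding.nonempty_of_card_le (by simpa using h)
    choose y x w hc using exists_capelli_eq_blockUnit (K := K) (n := n') hd'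
    choose t ht using exists_sumTrace_blockUnit_mul (K := K) (n := n') (k := k)
    let g : GramVar _ _ → ∀ j : Fin s, Matrix (Fin (n' j)) (Fin (n' j)) K :=
      Sum.elim (fun _ => 1) <| Sum.elim (fun l => y (e l)) <| Sum.elim (fun l => t (e l)) <|
        Sum.elim (fun c => x (e c.1) c.2) fun c => w (e c.1) c.2
    let a : ℕ → ∀ j : Fin s, Matrix (Fin (n' j)) (Fin (n' j)) K := Function.extend enc g 1
    have ha : ∀ c, a (enc c) = g c := henc.extend_apply g 1
    have h1 := hf ⟨⟨s, n'⟩, a⟩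
    have h0 := hid a
    simp only [sumTrace_apply] at h1
    have h2 := h1.symm.trans h0
    simp only [← sumTrace_apply, ha] at h2
    have h3 : (Matrix.of fun l m => sumTrace K n' (capelli (y (e l)) (x (e l)) (w (e l)) *
        t (e m))) = 1 := by
      ext l m
      simp [hc, ht, Matrix.one_apply]
    have h4 : Matrix.det (Matrix.of fun l m => sumTrace K n'
        (capelli (y (e l)) (x (e l)) (w (e l)) * t (e m))) •
          (1 : ∀ j : Fin s, Matrix (Fin (n' j)) (Fin (n' j)) K) = 0 := h2
    rw [h3, Matrix.det_one, one_smul] at h4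
    obtain ⟨⟨j, hj⟩, p, q⟩ := e 0
    simpa using congrFun (congrFun (congrFun h4 j) p) p

theorem matrix_products_different_multisets_different_traceIdentities
    (K : Type*) [Field K] [IsAlgClosed K]
    (r s : ℕ) (hr : 1 ≤ r) (hs : 1 ≤ s)
    (n : Fin r → ℕ) (n' : Fin s → ℕ)
    (hpos : ∀ i, 1 ≤ n i) (hpos' : ∀ j, 1 ≤ n' j)
    (hne : (Finset.univ.val.map n : Multiset ℕ) ≠ (Finset.univ.val.map n' : Multiset ℕ)) :
    ∃ f : TraceTerm →₀ K,
      (IsTracePI (A := ∀ i : Fin r, Matrix (Fin (n i)) (Fin (n i)) K)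
          (fun a => (∑ i, Matrix.trace (a i)) • 1) f ∧
        ¬ IsTracePI (A := ∀ j : Fin s, Matrix (Fin (n' j)) (Fin (n' j)) K)
          (fun a => (∑ j, Matrix.trace (a j)) • 1) f) ∨
      (IsTracePI (A := ∀ j : Fin s, Matrix (Fin (n' j)) (Fin (n' j)) K)
          (fun a => (∑ j, Matrix.trace (a j)) • 1) f ∧
        ¬ IsTracePI (A := ∀ i : Fin r, Matrix (Fin (n i)) (Fin (n i)) K)
          (fun a => (∑ i, Matrix.trace (a i)) • 1) f) := by
  obtain ⟨k, hk⟩ : ∃ k, Fintype.card (LargeBlockEntry n k) ≠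
      Fintype.card (LargeBlockEntry n' k) := by
    by_contra! h
    exact hne (map_eq_of_card_largeBlockEntry_eq hpos hpos' h)
  obtain hk | hk := hk.lt_or_gt
  · obtain ⟨f, hf⟩ := exists_isTracePI_of_card_largeBlockEntry_lt K hk
    exact ⟨f, .inl hf⟩
  · obtain ⟨f, hf⟩ := exists_isTracePI_of_card_largeBlockEntry_lt K hk
    exact ⟨f, .inr hf⟩
end
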